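/- arXiv:0812.2817 — 2 statements merged into one kernel-verified Lean document; each statement's English description precedes it below -/
import Mathlib

section
/- The Tutte polynomial of the complete graph K_{n+1} satisfies T_{K_{n+1}}(x,y) = Σ_{α ∈ P_n} x^{cm(α)} y^{C(n,2) - Σ_{i=1}^n a_i}, where the sum is over all classical parking functions α = (a_1,...,a_n) of length n and cm(α) is the number of α-critical maxima. -/
open Finset

/-- Number of edges of the multigraph with edge multiset `E` joining `v` to a vertex outside `I`. -/
def outdeg {V : Type} [Fintype V] [DecidableEq V] (E : Multiset (Sym2 V))
    (I : Finset V) (v : V) : ℕ :=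
  Multiset.card (E.filter (fun e => ∃ w, w ∉ I ∧ e = s(v, w)))

/-- `f` is a `G`-parking function with root `r`, where `G` has edge multiset `E`. -/
def IsGPF {V : Type} [Fintype V] [DecidableEq V] (E : Multiset (Sym2 V)) (r : V)
    (f : V → ℤ) : Prop :=
  f r = -1 ∧ ∀ I : Finset V, I.Nonempty → r ∉ I →
    ∃ v ∈ I, 0 ≤ f v ∧ f v < (outdeg E I v : ℤ)

/-- The simple graph underlying the multigraph with edge multiset `E`. -/
def mAdj {V : Type} [DecidableEq V] (E : Multiset (Sym2 V)) : SimpleGraph V :=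
  SimpleGraph.fromRel (fun v w => s(v, w) ∈ E)

/-- classical parking function. -/
def IsPF (n : ℕ) (a : Fin n → ℕ) : Prop :=
  ∃ σ : Equiv.Perm (Fin n), Monotone (a ∘ σ) ∧ ∀ i : Fin n, (a ∘ σ) i ≤ i

def IsCritMax (n : ℕ) (a : Fin n → ℕ) (i : Fin n) : Prop :=
  (univ.filter (fun k => a i < a k)).card = n - 1 - a i ∧ ∀ k, a i < a k → k < i

open scoped Classical in
noncomputable def cm (n : ℕ) (a : Fin n → ℕ) : ℕ :=
  (univ.filter (IsCritMax n a)).card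

noncomputable def comps {V : Type} [Fintype V] [DecidableEq V] (M : Multiset (Sym2 V)) : ℕ :=
  Nat.card (mAdj M).ConnectedComponent

noncomputable def rk {V : Type} [Fintype V] [DecidableEq V] (M : Multiset (Sym2 V)) : ℕ :=
  Fintype.card V - comps M

/-- Tutte polynomial (Whitney rank formula) of the multigraph with edges indexed by `ε`. -/
noncomputable def tutte {V : Type} [Fintype V] [DecidableEq V] {ε : Type} [Fintype ε]
    (ends : ε → Sym2 V) (x y : ℤ) : ℤ :=
  ∑ A : Finset ε,
    (x - 1) ^ (rk (Finset.univ.val.map ends) - rk (A.val.map ends)) *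
      (y - 1) ^ (A.card - rk (A.val.map ends))

noncomputable def tutteK (n : ℕ) (x y : ℤ) : ℤ :=
  tutte (fun e : ↥(⊤ : SimpleGraph (Fin (n + 1))).edgeFinset => (e : Sym2 (Fin (n + 1)))) x y

namespace SimpleGraph

variable {V W : Type}

/-- The number of connected components. -/
noncomputable def numComp (G : SimpleGraph V) : ℕ := Nat.card G.ConnectedComponent

/-- The number of edges. -/
noncomputable def numEdges (G : SimpleGraph V) : ℕ := Nat.card G.edgeSet

lemma Iso.numComp_eq {G : SimpleGraph V} {H : SimpleGraph W} (e : G ≃g H) :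
    G.numComp = H.numComp :=
  Nat.card_congr e.connectedComponentEquiv

lemma Iso.numEdges_eq {G : SimpleGraph V} {H : SimpleGraph W} (e : G ≃g H) :
    G.numEdges = H.numEdges :=
  Nat.card_congr e.mapEdgeSet

/-- The components of a disjoint sum are the components of the two summands. -/
def connectedComponentSumEquiv (G : SimpleGraph V) (H : SimpleGraph W) :
    G.ConnectedComponent ⊕ H.ConnectedComponent ≃ (G ⊕g H).ConnectedComponent where
  toFun := Sum.elim (ConnectedComponent.map Embedding.sumInl.toHom)
    (ConnectedComponent.map Embedding.sumInr.toHom)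
  invFun := ConnectedComponent.lift
    (Sum.map G.connectedComponentMk H.connectedComponentMk) (by
      intro v w p hp
      clear hp
      induction p with
      | nil => rfl
      | @cons u v w h p ih =>
        rw [← ih]
        rcases u with u | u <;> rcases v with v | v <;> simp at h ⊢ <;> exact h.reachable)
  left_inv := by
    rintro (c | c) <;> induction c using ConnectedComponent.ind <;> rfl
  right_inv := by
    intro c
    induction c using ConnectedComponent.ind with
    | _ v => rcases v with v | v <;> rfl

lemma numComp_sum [Finite V] [Finite W] (G : SimpleGraph V) (H : SimpleGraph W) :
    (G ⊕g H).numComp = G.numComp + H.numComp := by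
  rw [numComp, ← Nat.card_congr (connectedComponentSumEquiv G H), Nat.card_sum]; rfl

lemma numEdges_sum [Finite V] [Finite W] (G : SimpleGraph V) (H : SimpleGraph W) :
    (G ⊕g H).numEdges = G.numEdges + H.numEdges := by
  rw [numEdges, Nat.card_congr edgeSetSumEquiv, Nat.card_sum]; rfl

lemma Connected.numComp_eq_one {G : SimpleGraph V} (h : G.Connected) : G.numComp = 1 := by
  have := h.preconnected.subsingleton_connectedComponent
  have := h.nonempty
  exact Nat.card_eq_one_iff_unique.2 ⟨inferInstance, ⟨G.connectedComponentMk this.some⟩⟩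

lemma numComp_pos [Finite V] [Nonempty V] (G : SimpleGraph V) : 0 < G.numComp :=
  have : Nonempty G.ConnectedComponent := ⟨G.connectedComponentMk (Classical.arbitrary V)⟩
  Nat.card_pos

lemma numComp_le_card [Finite V] (G : SimpleGraph V) : G.numComp ≤ Nat.card V :=
  Nat.card_le_card_of_surjective G.connectedComponentMk Quot.mk_surjective

/-- The graph on `V` that is `H` on `S` and `K` on the complement of `S`. -/
def glue [DecidableEq V] (S : Finset V) (H : SimpleGraph {v // v ∈ S})
    (K : SimpleGraph {v // v ∉ S}) : SimpleGraph V :=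
  (H ⊕g K).comap (Equiv.sumCompl (· ∈ S)).symm

/-- A glued graph is isomorphic to the disjoint sum of its parts. -/
def glueIso [DecidableEq V] (S : Finset V) (H : SimpleGraph {v // v ∈ S})
    (K : SimpleGraph {v // v ∉ S}) : glue S H K ≃g (H ⊕g K) :=
  Iso.comap (Equiv.sumCompl (· ∈ S)).symm _

lemma glue_comap [DecidableEq V] {S : Finset V} {G : SimpleGraph V}
    (h : ∀ u v, G.Adj u v → u ∈ S → v ∈ S) :
    glue S (G.comap (↑)) (G.comap (↑)) = G := by
  ext u v
  by_cases hu : u ∈ S <;> by_cases hv : v ∈ S <;>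
    simp [glue, Equiv.sumCompl_symm_apply_of_pos, Equiv.sumCompl_symm_apply_of_neg, hu, hv]
  · exact fun huv => hv (h _ _ huv hu)
  · exact fun huv => hu (h _ _ huv.symm hv)

lemma comap_glue_mem [DecidableEq V] (S : Finset V) (H : SimpleGraph {v // v ∈ S})
    (K : SimpleGraph {v // v ∉ S}) : (glue S H K).comap (↑) = H := by
  ext u v
  simp [glue]

lemma comap_glue_notMem [DecidableEq V] (S : Finset V) (H : SimpleGraph {v // v ∈ S})
    (K : SimpleGraph {v // v ∉ S}) : (glue S H K).comap (↑) = K := by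
  ext u v
  simp [glue]

lemma reachable_glue_iff [DecidableEq V] {S : Finset V} {H : SimpleGraph {v // v ∈ S}}
    {K : SimpleGraph {v // v ∉ S}} (hH : H.Connected) {r : V} (hr : r ∈ S) (v : V) :
    (glue S H K).Reachable r v ↔ v ∈ S := by
  rw [← (glueIso S H K).reachable_iff]
  have h1 : glueIso S H K r = .inl ⟨r, hr⟩ := Equiv.sumCompl_symm_apply_of_pos hr
  rw [h1]
  by_cases hv : v ∈ S
  · have h2 : glueIso S H K v = .inl ⟨v, hv⟩ := Equiv.sumCompl_symm_apply_of_pos hv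
    rw [h2]
    exact iff_of_true ((hH.preconnected ⟨r, hr⟩ ⟨v, hv⟩).map Embedding.sumInl.toHom) hv
  · have h2 : glueIso S H K v = .inr ⟨v, hv⟩ := Equiv.sumCompl_symm_apply_of_neg hv
    rw [h2]
    exact iff_of_false (not_reachable_sum_inl_inr _ _) hv

lemma connected_comap_of_reachable_iff {S : Finset V} {G : SimpleGraph V} {r : V}
    (h : ∀ v, G.Reachable r v ↔ v ∈ S) : (G.comap ((↑) : {v // v ∈ S} → V)).Connected := by
  have hS : (G.connectedComponentMk r).supp = {v | v ∈ S} := by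
    ext v
    simp [← h, reachable_comm]
  have := (G.connectedComponentMk r).connected_toSimpleGraph
  unfold ConnectedComponent.toSimpleGraph at this
  have h2 : (G.induce (G.connectedComponentMk r).supp).Connected := this
  rw [hS] at h2
  exact h2

lemma mem_of_adj_of_reachable_iff {S : Finset V} {G : SimpleGraph V} {r : V}
    (h : ∀ v, G.Reachable r v ↔ v ∈ S) (u v : V) (huv : G.Adj u v) (hu : u ∈ S) : v ∈ S :=
  (h v).1 (((h u).2 hu).trans huv.reachable)

/-- The number of edges is at least the size of a spanning forest. -/
lemma card_le_numEdges_add_numComp [Finite V] (G : SimpleGraph V) :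
    Nat.card V ≤ G.numEdges + G.numComp := by
  classical
  have := Fintype.ofFinite V
  induction hn : Nat.card V using Nat.strong_induction_on generalizing V with
  | _ n ih =>
  rcases isEmpty_or_nonempty V with hV | ⟨⟨r⟩⟩
  · simp at hn; omega
  · let S : Finset V := univ.filter (G.Reachable r)
    have hS : ∀ v, G.Reachable r v ↔ v ∈ S := by simp [S]
    have hrS : r ∈ S := (hS r).1 .rfl
    have hG := glue_comap (mem_of_adj_of_reachable_iff hS)
    have hconn := connected_comap_of_reachable_iff hS
    have h1 := hconn.card_vert_le_card_edgeSet_add_one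
    have hc : Nat.card {v // v ∈ S} + Nat.card {v // v ∉ S} = Nat.card V := by
      rw [← Nat.card_sum, Nat.card_congr (Equiv.sumCompl (· ∈ S))]
    have hpos : 0 < Nat.card {v // v ∈ S} :=
      have : Nonempty {v // v ∈ S} := ⟨⟨r, hrS⟩⟩
      Nat.card_pos
    have h2 := ih (Nat.card {v // v ∉ S}) (by omega) (G.comap ((↑) : {v // v ∉ S} → V))
      inferInstance rfl
    rw [← hG, (glueIso S _ _).numComp_eq, (glueIso S _ _).numEdges_eq, numComp_sum, numEdges_sum,
      hconn.numComp_eq_one]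
    change _ ≤ numEdges _ + 1 at h1
    omega

open scoped Classical in
/-- The partition function of the graphs on `V`, by number of components and of edges. -/
noncomputable def graphSum (V : Type) [Fintype V] (z w : ℤ) : ℤ :=
  ∑ G : SimpleGraph V, z ^ G.numComp * w ^ G.numEdges

open scoped Classical in
/-- The generating function of the connected graphs on `V`, by number of edges. -/
noncomputable def connSum (V : Type) [Fintype V] (w : ℤ) : ℤ :=
  ∑ G : SimpleGraph V with G.Connected, w ^ G.numEdges

lemma graphSum_congr [Fintype V] [Fintype W] (e : V ≃ W) (z w : ℤ) :
    graphSum V z w = graphSum W z w := by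
  classical
  refine Fintype.sum_equiv e.simpleGraph _ _ fun G => ?_
  have : e.simpleGraph G = G.map e := (SimpleGraph.map_symm G e.symm).symm
  rw [(Iso.map e G).numComp_eq, (Iso.map e G).numEdges_eq, this]

lemma connSum_congr [Fintype V] [Fintype W] (e : V ≃ W) (w : ℤ) :
    connSum V w = connSum W w := by
  classical
  have : ∀ G, e.simpleGraph G = G.map e := fun G => (SimpleGraph.map_symm G e.symm).symm
  refine Finset.sum_equiv e.simpleGraph (fun G => ?_) fun G _ => ?_
  · simp only [Finset.mem_filter_univ]
    rw [(Iso.map e G).connected_iff, this]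
  · rw [(Iso.map e G).numEdges_eq, this]

lemma graphSum_eq_sum_component [Fintype V] [DecidableEq V] (r : V) (z w : ℤ) :
    graphSum V z w = ∑ S : Finset V with r ∈ S,
      connSum {v // v ∈ S} w * (z * graphSum {v // v ∉ S} z w) := by
  classical
  have key : ∀ (G : SimpleGraph V) (S : Finset V),
      (univ.filter (G.Reachable r) = S) ↔ ∀ v, G.Reachable r v ↔ v ∈ S := by
    intro G S; simp [Finset.ext_iff]
  rw [graphSum, ← Finset.sum_fiberwise_of_maps_to
    (t := univ.filter fun S : Finset V => r ∈ S)
    (g := fun G : SimpleGraph V => univ.filter (G.Reachable r)) (by simp)]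
  refine Finset.sum_congr rfl fun S hS => ?_
  have hr : r ∈ S := by simpa using hS
  rw [connSum, graphSum, Finset.mul_sum, Finset.sum_mul_sum, ← Finset.sum_product']
  symm
  refine Finset.sum_bij' (fun p _ => glue S p.1 p.2)
    (fun G _ => (G.comap (↑), G.comap (↑))) ?_ ?_ ?_ ?_ ?_
  · rintro ⟨H, K⟩ h
    simp only [Finset.mem_product, Finset.mem_filter_univ, Finset.mem_univ, and_true] at h
    simp only [Finset.mem_filter_univ, key]
    exact reachable_glue_iff h hr
  · intro G h
    simp only [Finset.mem_filter_univ, key] at h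
    simpa using connected_comap_of_reachable_iff h
  · rintro ⟨H, K⟩ h
    simp only [comap_glue_mem, comap_glue_notMem]
  · intro G h
    simp only [Finset.mem_filter_univ, key] at h
    exact glue_comap (mem_of_adj_of_reachable_iff h)
  · rintro ⟨H, K⟩ h
    simp only [Finset.mem_product, Finset.mem_filter_univ, Finset.mem_univ, and_true] at h
    simp only [(glueIso S H K).numComp_eq, (glueIso S H K).numEdges_eq, numComp_sum, numEdges_sum,
      h.numComp_eq_one]
    ring

/-- Sums over the sets containing a given point, of a function of the cardinality. -/
lemma sum_filter_mem_card {M : Type*} [AddCommMonoid M] (n : ℕ) (f : ℕ → M) :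
    ∑ S : Finset (Fin (n + 1)) with 0 ∈ S, f S.card =
      ∑ k ∈ range (n + 1), n.choose k • f (k + 1) := by
  have h := Finset.sum_powerset_apply_card (fun k => f (k + 1))
    (x := (univ : Finset (Fin (n + 1))).erase 0)
  rw [Finset.card_erase_of_mem (mem_univ _), Finset.card_univ, Fintype.card_fin,
    Nat.add_sub_cancel] at h
  rw [← h]
  refine Finset.sum_bij' (fun S _ => S.erase 0) (fun S _ => insert 0 S) ?_ ?_ ?_ ?_ ?_
  · intro S _
    exact mem_powerset.2 (erase_subset_erase _ (subset_univ _))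
  · intro S _
    simp
  · intro S hS
    exact insert_erase (by simpa using hS)
  · intro S hS
    exact erase_insert fun h => by simpa using mem_powerset.1 hS h
  · intro S hS
    have : 0 ∈ S := by simpa using hS
    rw [card_erase_add_one this]

lemma graphSum_fin_succ (n : ℕ) (z w : ℤ) :
    graphSum (Fin (n + 1)) z w = ∑ k ∈ range (n + 1),
      (n.choose k : ℤ) * (connSum (Fin (k + 1)) w * (z * graphSum (Fin (n - k)) z w)) := by
  classical
  rw [graphSum_eq_sum_component 0]
  have := sum_filter_mem_card n fun k =>
    connSum (Fin k) w * (z * graphSum (Fin (n + 1 - k)) z w)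
  simp only [nsmul_eq_mul] at this
  refine Eq.trans ?_ (this.trans (Finset.sum_congr rfl fun k _ => by
    rw [Nat.add_sub_add_right n 1 k]))
  refine Finset.sum_congr rfl fun S _ => ?_
  rw [connSum_congr (Fintype.equivFinOfCardEq (n := S.card) (by simp)),
    graphSum_congr (Fintype.equivFinOfCardEq (α := {v // v ∉ S}) (n := n + 1 - S.card) ?_)]
  rw [Fintype.card_subtype_compl]
  simp

end SimpleGraph

section EdgeSubsets

open SimpleGraph

variable {V : Type} [Fintype V] [DecidableEq V]

lemma edgeSet_mAdj (A : Finset ↥(⊤ : SimpleGraph V).edgeFinset) :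
    (mAdj (A.val.map Subtype.val)).edgeSet =
      Subtype.val '' (A : Set ↥(⊤ : SimpleGraph V).edgeFinset) := by
  ext e
  induction e using Sym2.ind with
  | _ u v =>
  simp only [mAdj, mem_edgeSet, fromRel_adj, Set.mem_image, Multiset.mem_map]
  constructor
  · rintro ⟨_, ⟨e, he, h⟩ | ⟨e, he, h⟩⟩
    · exact ⟨e, he, h⟩
    · exact ⟨e, he, h.trans Sym2.eq_swap⟩
  · rintro ⟨e, he, h⟩
    refine ⟨?_, .inl ⟨e, he, h⟩⟩
    have := e.2
    rw [h] at this
    simpa using this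

lemma numEdges_mAdj (A : Finset ↥(⊤ : SimpleGraph V).edgeFinset) :
    (mAdj (A.val.map Subtype.val)).numEdges = A.card := by
  rw [numEdges, edgeSet_mAdj, Nat.card_image_of_injective Subtype.val_injective]
  simp

lemma mAdj_bijective :
    Function.Bijective fun A : Finset ↥(⊤ : SimpleGraph V).edgeFinset =>
      mAdj (A.val.map Subtype.val) := by
  classical
  constructor
  · intro A B h
    have := congrArg edgeSet h
    rw [edgeSet_mAdj, edgeSet_mAdj] at this
    exact Finset.coe_injective (Subtype.val_injective.image_injective this)
  · intro G
    refine ⟨univ.filter fun e => (e : Sym2 V) ∈ G.edgeSet, ?_⟩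
    rw [← edgeSet_inj, edgeSet_mAdj]
    ext e
    simp only [Set.mem_image, Finset.coe_filter, Finset.mem_univ, true_and, Set.mem_ofPred_eq]
    constructor
    · rintro ⟨e, he, rfl⟩
      exact he
    · intro he
      exact ⟨⟨e, mem_edgeFinset.2 (edgeSet_mono le_top he)⟩, he, rfl⟩

lemma graphSum_eq_sum_mAdj (z w : ℤ) :
    graphSum V z w = ∑ A : Finset ↥(⊤ : SimpleGraph V).edgeFinset,
      z ^ (mAdj (A.val.map Subtype.val)).numComp * w ^ A.card := by
  classical
  have h (A : Finset ↥(⊤ : SimpleGraph V).edgeFinset) :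
      z ^ (mAdj (A.val.map Subtype.val)).numComp * w ^ A.card =
        (fun G : SimpleGraph V => z ^ G.numComp * w ^ G.numEdges)
          ((fun A : Finset ↥(⊤ : SimpleGraph V).edgeFinset => mAdj (A.val.map Subtype.val)) A) := by
    simp only [numEdges_mAdj]
  rw [graphSum, Finset.sum_congr rfl fun A _ => h A]
  convert (mAdj_bijective.sum_comp fun G : SimpleGraph V => z ^ G.numComp * w ^ G.numEdges).symm

lemma graphSum_one (n : ℕ) (w : ℤ) : graphSum (Fin n) 1 w = (1 + w) ^ n.choose 2 := by
  classical
  rw [graphSum_eq_sum_mAdj]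
  simp only [one_pow, one_mul]
  have := Fintype.sum_pow_mul_eq_add_pow ↥(⊤ : SimpleGraph (Fin n)).edgeFinset w (1 : ℤ)
  simp only [one_pow, mul_one] at this
  rw [this, Fintype.card_coe, card_edgeFinset_top_eq_card_choose_two, Fintype.card_fin, add_comm]

lemma mul_tutteK (n : ℕ) (x y : ℤ) :
    (x - 1) * (y - 1) ^ (n + 1) * tutteK n x y =
      graphSum (Fin (n + 1)) ((x - 1) * (y - 1)) (y - 1) := by
  classical
  rw [graphSum_eq_sum_mAdj, tutteK, _root_.tutte, Finset.mul_sum]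
  refine Finset.sum_congr rfl fun A _ => ?_
  set G := mAdj (A.val.map Subtype.val) with hG
  have h1 := G.numComp_pos
  have h2 := G.numComp_le_card
  have h3 := G.card_le_numEdges_add_numComp
  have hT : mAdj (Finset.univ.val.map
      fun e : ↥(⊤ : SimpleGraph (Fin (n + 1))).edgeFinset => (e : Sym2 (Fin (n + 1)))) = ⊤ := by
    rw [← edgeSet_inj, edgeSet_mAdj]
    ext e
    simp
  have h4 : comps (Finset.univ.val.map
      fun e : ↥(⊤ : SimpleGraph (Fin (n + 1))).edgeFinset => (e : Sym2 (Fin (n + 1)))) = 1 := by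
    rw [comps, hT]
    exact Connected.numComp_eq_one connected_top
  have h5 : comps (A.val.map Subtype.val) = G.numComp := rfl
  have h6 : G.numEdges = A.card := numEdges_mAdj A
  rw [rk, rk, h4, h5]
  rw [h6] at h3
  simp only [Nat.card_eq_fintype_card, Fintype.card_fin] at h2 h3 ⊢
  obtain ⟨c, hc⟩ : ∃ c, G.numComp = c + 1 := ⟨G.numComp - 1, by omega⟩
  obtain ⟨d, hd⟩ : ∃ d, n = c + d := ⟨n - c, by omega⟩
  obtain ⟨a, ha⟩ : ∃ a, A.card = d + a := ⟨A.card - d, by omega⟩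
  rw [hc, ha, show n + 1 - 1 - (n + 1 - (c + 1)) = c by omega,
    show d + a - (n + 1 - (c + 1)) = a by omega, hd, mul_pow]
  ring

end EdgeSubsets

namespace ParkingFunction

variable {ι κ : Type}

/-- Parking functions on a finite index type: for every `j` below the number of indices, more than
`j` of the values are at most `j`. -/
def Parking (ι : Type) [Fintype ι] (a : ι → ℕ) : Prop :=
  ∀ j < Fintype.card ι, j < (univ.filter fun i => a i ≤ j).card

lemma Parking.lt [Fintype ι] {a : ι → ℕ} (h : Parking ι a) (i : ι) :
    a i < Fintype.card ι := by
  have hpos : 0 < Fintype.card ι := Fintype.card_pos_iff.2 ⟨i⟩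
  have h1 := h (Fintype.card ι - 1) (by omega)
  have h2 : univ.filter (fun i => a i ≤ Fintype.card ι - 1) = univ :=
    eq_univ_of_card _ (le_antisymm (card_le_univ _) (by omega))
  have h3 := (Finset.ext_iff.1 h2 i).2 (mem_univ i)
  have h4 := (mem_filter.1 h3).2
  omega

lemma parking_comp_equiv [Fintype ι] [Fintype κ] (e : κ ≃ ι) {a : ι → ℕ} :
    Parking κ (a ∘ e) ↔ Parking ι a := by
  refine forall_congr' fun j => ?_
  rw [Fintype.card_congr e]
  have : (univ.filter fun i => (a ∘ e) i ≤ j).card = (univ.filter fun i => a i ≤ j).card :=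
    Finset.card_equiv e (by simp)
  rw [this]

lemma isPF_iff_parking (n : ℕ) (a : Fin n → ℕ) : IsPF n a ↔ Parking (Fin n) a := by
  constructor
  · rintro ⟨σ, -, h⟩ j hj
    rw [Fintype.card_fin] at hj
    have hsub : (Finset.Iic (⟨j, hj⟩ : Fin n)).map σ.toEmbedding ⊆ univ.filter fun i => a i ≤ j := by
      intro i hi
      obtain ⟨k, hk, rfl⟩ := mem_map.1 hi
      have h1 : k ≤ ⟨j, hj⟩ := Finset.mem_Iic.1 hk
      exact mem_filter.2 ⟨mem_univ _, (h k).trans h1⟩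
    have := card_le_card hsub
    rw [card_map, Fin.card_Iic] at this
    exact this
  · intro h
    refine ⟨Tuple.sort a, Tuple.monotone_sort a, fun i => ?_⟩
    by_contra! hi
    have hsub : univ.filter (fun k => a k ≤ i) ⊆ (Finset.Iio i).map (Tuple.sort a).toEmbedding := by
      intro k hk
      refine mem_map.2 ⟨(Tuple.sort a).symm k, ?_, by simp⟩
      rw [Finset.mem_Iio]
      by_contra! hik
      have h1 := Tuple.monotone_sort a hik
      simp only [Function.comp_apply, Equiv.apply_symm_apply] at h1 hi
      have h2 := (mem_filter.1 hk).2
      omega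
    have h1 := card_le_card hsub
    rw [card_map, Fin.card_Iio] at h1
    have h2 := h i (by simp)
    omega

lemma Parking.sum_le [Fintype ι] {a : ι → ℕ} (h : Parking ι a) :
    ∑ i, a i ≤ (Fintype.card ι).choose 2 := by
  obtain ⟨σ, -, hσ⟩ :=
    (isPF_iff_parking _ _).2 ((parking_comp_equiv (Fintype.equivFin ι).symm).2 h)
  rw [← Equiv.sum_comp (Fintype.equivFin ι).symm, ← Equiv.sum_comp σ]
  refine (Finset.sum_le_sum fun i _ => hσ i).trans_eq ?_
  rw [Fin.sum_univ_eq_sum_range fun i => i, Finset.sum_range_id, Nat.choose_two_right]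

open scoped Classical in
/-- The finite set of parking functions on `ι`. -/
noncomputable def parkingFinset (ι : Type) [Fintype ι] : Finset (ι → ℕ) :=
  (Fintype.piFinset fun _ => range (Fintype.card ι)).filter (Parking ι)

@[simp]
lemma mem_parkingFinset [Fintype ι] {a : ι → ℕ} : a ∈ parkingFinset ι ↔ Parking ι a := by
  classical
  simp only [parkingFinset, mem_filter, Fintype.mem_piFinset, mem_range, and_iff_right_iff_imp]
  exact fun h => h.lt

/-- The indices of critical maxima. -/
def critSet (ι : Type) [Fintype ι] [LinearOrder ι] (a : ι → ℕ) : Finset ι :=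
  univ.filter fun i => (univ.filter fun k => a i < a k).card = Fintype.card ι - 1 - a i ∧
    ∀ k, a i < a k → k < i

lemma cm_eq_card_critSet (n : ℕ) (a : Fin n → ℕ) : cm n a = (critSet (Fin n) a).card := by
  rw [cm, critSet]
  congr 1
  ext i
  simp [IsCritMax]

/-- The generating function of parking functions by critical maxima and complemented sum. -/
noncomputable def parkSum (ι : Type) [Fintype ι] [LinearOrder ι] (x y : ℤ) : ℤ :=
  ∑ a ∈ parkingFinset ι, x ^ (critSet ι a).card * y ^ ((Fintype.card ι).choose 2 - ∑ i, a i)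

lemma parkSum_congr [Fintype ι] [LinearOrder ι] [Fintype κ] [LinearOrder κ] (e : κ ≃o ι)
    (x y : ℤ) : parkSum ι x y = parkSum κ x y := by
  have hcard : Fintype.card κ = Fintype.card ι := Fintype.card_congr e.toEquiv
  refine Finset.sum_equiv (e.toEquiv.symm.arrowCongr (Equiv.refl ℕ)) (fun a => ?_) fun a _ => ?_
  · rw [mem_parkingFinset, mem_parkingFinset]
    exact (parking_comp_equiv e.toEquiv).symm
  · have hcomp : e.toEquiv.symm.arrowCongr (Equiv.refl ℕ) a = a ∘ e.toEquiv := rfl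
    rw [hcomp, hcard]
    have h1 : (critSet κ (a ∘ e.toEquiv)).card = (critSet ι a).card := by
      refine Finset.card_equiv e.toEquiv fun i => ?_
      have h2 : (univ.filter fun k => (a ∘ e.toEquiv) i < (a ∘ e.toEquiv) k).card =
          (univ.filter fun k => a (e.toEquiv i) < a k).card :=
        Finset.card_equiv e.toEquiv (by simp)
      have h3 : (∀ k, (a ∘ e.toEquiv) i < (a ∘ e.toEquiv) k → k < i) ↔
          ∀ k, a (e.toEquiv i) < a k → k < e.toEquiv i := by
        rw [e.toEquiv.forall_congr_left]
        refine forall_congr' fun k => ?_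
        have : e.symm k < i ↔ k < e i := e.symm_apply_lt
        simpa using imp_congr_right fun _ => this
      simp only [critSet, Finset.mem_filter_univ, h2, h3, hcard]
      rfl
    have h2 : ∑ i, (a ∘ e.toEquiv) i = ∑ i, a i := Equiv.sum_comp e.toEquiv a
    rw [h1, h2]

lemma parkSum_coe {n : ℕ} (S : Finset (Fin n)) (x y : ℤ) :
    parkSum {i // i ∈ S} x y = parkSum (Fin S.card) x y :=
  parkSum_congr (S.orderIsoOfFin rfl) x y

section MaximalParkingPart

variable [Fintype ι]

/-- The index set of the longest parking function made of smallest values of `a`. -/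
noncomputable def parkingPart (a : ι → ℕ) : Finset ι :=
  univ.filter fun i => a i ≤ Nat.find (p := fun k => (univ.filter fun i => a i ≤ k).card ≤ k)
    ⟨Fintype.card ι, card_le_univ _⟩

lemma card_filter_coe_le [DecidableEq ι] (S : Finset ι) (a : ι → ℕ) (j : ℕ) :
    (univ.filter fun i : {i // i ∈ S} => a i ≤ j).card ≤ (univ.filter fun i => a i ≤ j).card := by
  rw [← card_map (Function.Embedding.subtype _)]
  refine card_le_card fun i hi => ?_
  obtain ⟨k, hk, rfl⟩ := mem_map.1 hi
  simpa using hk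

lemma card_filter_coe_eq [DecidableEq ι] {S : Finset ι} {a : ι → ℕ} {j : ℕ}
    (h : ∀ i, a i ≤ j → i ∈ S) :
    (univ.filter fun i : {i // i ∈ S} => a i ≤ j).card = (univ.filter fun i => a i ≤ j).card := by
  refine (card_filter_coe_le S a j).antisymm ?_
  rw [← card_map (Function.Embedding.subtype _)]
  refine card_le_card fun i hi => ?_
  have hi := (mem_filter.1 hi).2
  exact mem_map.2 ⟨⟨i, h i hi⟩, by simpa using hi, rfl⟩

lemma parkingPart_eq_iff [DecidableEq ι] (a : ι → ℕ) (S : Finset ι) :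
    parkingPart a = S ↔
      Parking {i // i ∈ S} (fun i => a i) ∧ ∀ i, i ∉ S → S.card < a i := by
  have hex : ∃ k, (univ.filter fun i => a i ≤ k).card ≤ k := ⟨Fintype.card ι, card_le_univ _⟩
  constructor
  · rintro rfl
    have hcard : (parkingPart a).card = Nat.find hex := by
      refine le_antisymm (Nat.find_spec hex) ?_
      by_contra! hlt
      have h1 := Nat.find_min hex (m := Nat.find hex - 1) (by omega)
      have h2 : (univ.filter fun i => a i ≤ Nat.find hex - 1).card ≤ (parkingPart a).card :=
        card_le_card fun i hi => by
          have := (mem_filter.1 hi).2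
          exact mem_filter.2 ⟨mem_univ _, this.trans (Nat.sub_le _ _)⟩
      omega
    refine ⟨fun j hj => ?_, fun i hi => ?_⟩
    · rw [Fintype.card_coe, hcard] at hj
      change j < (univ.filter fun i : {i // i ∈ parkingPart a} => a i ≤ j).card
      rw [card_filter_coe_eq (S := parkingPart a) (a := a) fun i hi => mem_filter.2 ⟨mem_univ _, hi.trans hj.le⟩]
      exact not_le.1 (Nat.find_min hex hj)
    · rw [hcard]
      by_contra! hle
      exact hi (mem_filter.2 ⟨mem_univ _, hle⟩)
  · rintro ⟨hP, hS⟩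
    have hmem : ∀ i, a i ≤ S.card → i ∈ S := fun i hi => by
      by_contra hiS
      have := hS i hiS
      omega
    have hfind : Nat.find hex = S.card := by
      refine (Nat.find_eq_iff hex).2 ⟨card_le_card fun i hi => hmem i (mem_filter.1 hi).2,
        fun j hj => ?_⟩
      have h1 : j < (univ.filter fun i : {i // i ∈ S} => a i ≤ j).card :=
        hP j (by rwa [Fintype.card_coe])
      have h2 := card_filter_coe_le S a j
      omega
    ext i
    simp only [parkingPart, mem_filter, mem_univ, true_and, hfind]
    refine ⟨hmem i, fun hi => ?_⟩
    have := hP.lt ⟨i, hi⟩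
    rw [Fintype.card_coe] at this
    exact this.le

lemma sum_prod_eq_sum_parkingPart [DecidableEq ι] (φ : ℕ → ℤ) (N : ℕ) (hN : Fintype.card ι < N) :
    (∑ v ∈ range N, φ v) ^ Fintype.card ι = ∑ S : Finset ι,
      (∑ b ∈ parkingFinset {i // i ∈ S}, ∏ i, φ (b i)) *
        (∑ v ∈ Finset.Ico (S.card + 1) N, φ v) ^ (Fintype.card ι - S.card) := by
  have hpow : (∑ v ∈ range N, φ v) ^ Fintype.card ι =
      ∑ a ∈ Fintype.piFinset fun _ : ι => range N, ∏ i, φ (a i) := by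
    rw [← Finset.prod_univ_sum, Finset.prod_const, Finset.card_univ]
  rw [hpow, ← Finset.sum_fiberwise _ parkingPart]
  refine Finset.sum_congr rfl fun S _ => ?_
  have hpow' : (∑ v ∈ Finset.Ico (S.card + 1) N, φ v) ^ (Fintype.card ι - S.card) =
      ∑ c ∈ Fintype.piFinset fun _ : {i // i ∉ S} => Finset.Ico (S.card + 1) N,
        ∏ i, φ (c i) := by
    rw [← Finset.prod_univ_sum, Finset.prod_const, Finset.card_univ, Fintype.card_subtype_compl,
      Fintype.card_coe]
  rw [hpow', Finset.sum_mul_sum, ← Finset.sum_product']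
  symm
  refine Finset.sum_bij' (fun p _ i => if h : i ∈ S then p.1 ⟨i, h⟩ else p.2 ⟨i, h⟩)
    (fun a _ => (fun i => a i, fun i => a i)) ?_ ?_ ?_ ?_ ?_
  · rintro ⟨b, c⟩ h
    simp only [mem_product, mem_parkingFinset, Fintype.mem_piFinset, Finset.mem_Ico] at h
    simp only [mem_filter, Fintype.mem_piFinset, mem_range, parkingPart_eq_iff]
    refine ⟨fun i => ?_, ?_, fun i hi => ?_⟩
    · split_ifs with hi
      · have := h.1.lt ⟨i, hi⟩
        rw [Fintype.card_coe] at this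
        have := S.card_le_univ
        omega
      · exact (h.2 _).2
    · convert h.1 using 2 with i
      simp
    · rw [dif_neg hi]
      exact (h.2 _).1
  · intro a h
    simp only [mem_filter, Fintype.mem_piFinset, mem_range, parkingPart_eq_iff] at h
    simp only [mem_product, mem_parkingFinset, Fintype.mem_piFinset, Finset.mem_Ico]
    exact ⟨h.2.1, fun i => ⟨h.2.2 i i.2, h.1 i⟩⟩
  · rintro ⟨b, c⟩ _
    ext i
    · simp
    · simp [i.2]
  · intro a _
    ext i
    simp
  · rintro ⟨b, c⟩ _
    rw [← Fintype.prod_subtype_mul_prod_subtype (· ∈ S)]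
    refine congrArg₂ _ ?_ ?_
    · exact Finset.prod_congr (by ext; simp) fun i _ => by simp
    · exact Finset.prod_congr (by ext; simp) fun i _ => by simp [i.2]

end MaximalParkingPart

/-- The telescoping weight whose tail sums are powers of `y`. -/
def tailWeight (n : ℕ) (y : ℤ) (v : ℕ) : ℤ :=
  y ^ (n - v) - if v < n then y ^ (n - (v + 1)) else 0

lemma sum_tailWeight (n : ℕ) (y : ℤ) {j : ℕ} (hj : j ≤ n) :
    ∑ v ∈ Finset.Ico j (n + 1), tailWeight n y v = y ^ (n - j) := by
  obtain ⟨m, rfl⟩ := Nat.exists_eq_add_of_le hj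
  clear hj
  induction m generalizing j with
  | zero => simp [tailWeight]
  | succ m ih =>
    rw [Finset.sum_eq_sum_Ico_succ_bot (by omega), show j + (m + 1) = j + 1 + m by omega, ih,
      tailWeight, if_pos (by omega)]
    ring

lemma two_mul_choose_two (n : ℕ) : 2 * n.choose 2 = n * (n - 1) := by
  rw [Nat.choose_two_right, Nat.mul_div_cancel' (Nat.even_mul_pred_self n).two_dvd]

lemma prod_tailWeight [Fintype ι] {n : ℕ} (y : ℤ) {b : ι → ℕ} (hb : Parking ι b)
    (hn : Fintype.card ι ≤ n) :
    ∏ i, tailWeight n y (b i) = (y - 1) ^ Fintype.card ι *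
      y ^ ((Fintype.card ι).choose 2 - ∑ i, b i) *
        y ^ ((Fintype.card ι).choose 2 + Fintype.card ι * (n - Fintype.card ι)) := by
  have h1 : ∀ i, tailWeight n y (b i) = (y - 1) * y ^ (n - 1 - b i) := fun i => by
    have := hb.lt i
    obtain ⟨m, rfl⟩ : ∃ m, n = b i + 1 + m := ⟨n - (b i + 1), by omega⟩
    rw [tailWeight, if_pos (by omega), show b i + 1 + m - b i = m + 1 by omega,
      show b i + 1 + m - (b i + 1) = m by omega, show b i + 1 + m - 1 - b i = m by omega]
    ring
  rw [Finset.prod_congr rfl fun i _ => h1 i, Finset.prod_mul_distrib, Finset.prod_const,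
    Finset.prod_pow_eq_pow_sum, Finset.card_univ, mul_assoc, ← pow_add]
  congr 2
  have h2 : ∑ i, (n - 1 - b i) + ∑ i, b i = Fintype.card ι * (n - 1) := by
    rw [← Finset.sum_add_distrib, Finset.sum_congr rfl (g := fun _ => n - 1) fun i _ => by
      have := hb.lt i
      omega]
    simp
  have h3 := hb.sum_le
  obtain ⟨m, rfl⟩ := Nat.exists_eq_add_of_le hn
  generalize Fintype.card ι = k at *
  have h4 : k * (k + m - 1) = 2 * k.choose 2 + k * m := by
    rw [two_mul_choose_two]
    rcases k with _ | k
    · simp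
    · rw [show k + 1 + m - 1 = k + m by omega, Nat.add_sub_cancel]
      ring
  rw [h4] at h2
  rw [Nat.add_sub_cancel_left]
  omega

lemma add_choose_two (m n : ℕ) :
    (m + n).choose 2 = m.choose 2 + n.choose 2 + m * n := by
  induction n with
  | zero => simp
  | succ n ih =>
    rw [← add_assoc, Nat.choose_succ_succ' (m + n), Nat.choose_succ_succ' n, ih]
    simp only [Nat.choose_one_right]
    ring

lemma pow_choose_two_eq_sum {y : ℤ} (hy : y ≠ 0) (n : ℕ) :
    y ^ (n + 1).choose 2 = ∑ k ∈ range (n + 1), (n.choose k : ℤ) *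
      ((y - 1) ^ k * parkSum (Fin k) 1 y * y ^ (n - k).choose 2) := by
  have h := sum_prod_eq_sum_parkingPart (ι := Fin n) (tailWeight n y) (n + 1) (by simp)
  rw [← Nat.Ico_zero_eq_range, sum_tailWeight n y n.zero_le, Fintype.card_fin, Nat.sub_zero] at h
  have hterm : ∀ S : Finset (Fin n),
      (∑ b ∈ parkingFinset {i // i ∈ S}, ∏ i, tailWeight n y (b i)) *
        (∑ v ∈ Finset.Ico (S.card + 1) (n + 1), tailWeight n y v) ^ (n - S.card) =
      y ^ n.choose 2 * ((y - 1) ^ S.card * parkSum (Fin S.card) 1 y *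
        y ^ (n - S.card).choose 2) := by
    intro S
    have hS : S.card ≤ n := card_finset_fin_le S
    rw [← parkSum_coe, parkSum, Finset.sum_congr rfl fun b hb =>
      prod_tailWeight y (mem_parkingFinset.1 hb) (by rwa [Fintype.card_coe])]
    simp only [Fintype.card_coe, one_pow, one_mul]
    rw [← Finset.sum_mul, ← Finset.mul_sum]
    have htail : (∑ v ∈ Finset.Ico (S.card + 1) (n + 1), tailWeight n y v) ^ (n - S.card) =
        y ^ (2 * (n - S.card).choose 2) := by
      rcases hS.eq_or_lt with h | h
      · simp [h]
      · rw [sum_tailWeight n y h, ← pow_mul, two_mul_choose_two, mul_comm]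
        rfl
    rw [htail]
    generalize S.card = k at *
    obtain ⟨m, rfl⟩ := Nat.exists_eq_add_of_le hS
    rw [Nat.add_sub_cancel_left, add_choose_two]
    ring
  rw [Finset.sum_congr rfl fun S _ => hterm S, ← Finset.mul_sum, ← Finset.powerset_univ,
    Finset.sum_powerset_apply_card fun k => (y - 1) ^ k * parkSum (Fin k) 1 y *
      y ^ (n - k).choose 2] at h
  have hn : (y ^ n) ^ n = y ^ n.choose 2 * y ^ (n + 1).choose 2 := by
    rw [← pow_mul, ← pow_add]
    congr 1
    have := two_mul_choose_two n
    have h2 := add_choose_two n 1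
    rcases n with _ | n
    · simp
    · simp at this h2
      nlinarith
  rw [hn] at h
  have := mul_left_cancel₀ (pow_ne_zero _ hy) h
  simpa using this

section CriticalMaxima

variable [Fintype ι] [LinearOrder ι]

/-- The indices outside `S` other than `i`. -/
def rest (i : ι) (S : Finset ι) : Finset ι := univ.filter fun k => k ∉ S ∧ k ≠ i

lemma mem_rest {i k : ι} {S : Finset ι} : k ∈ rest i S ↔ k ∉ S ∧ k ≠ i := by
  simp [rest]

lemma sum_split {i : ι} {S : Finset ι} (hi : i ∉ S) (f : ι → ℕ) :
    ∑ k, f k = ∑ k : {k // k ∈ S}, f k + f i + ∑ k : {k // k ∈ rest i S}, f k := by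
  rw [Finset.sum_coe_sort S f, Finset.sum_coe_sort (rest i S) f, add_right_comm, ← add_comm (f i)]
  have h1 : Disjoint S (rest i S) :=
    Finset.disjoint_left.2 fun k hk hk' => (mem_rest.1 hk').1 hk
  have h2 : i ∉ S ∪ rest i S := by simp [mem_rest, hi]
  rw [← Finset.sum_union h1, ← Finset.sum_insert h2]
  congr 1
  ext k
  simp only [mem_univ, mem_insert, mem_union, mem_rest, true_iff]
  tauto

lemma card_split {i : ι} {S : Finset ι} (hi : i ∉ S) (p : ι → Prop) [DecidablePred p] :
    (univ.filter p).card = (univ.filter fun k : {k // k ∈ S} => p k).card +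
      (if p i then 1 else 0) + (univ.filter fun k : {k // k ∈ rest i S} => p k).card := by
  simp only [Finset.card_filter]
  exact sum_split hi fun k => if p k then 1 else 0

lemma card_eq_split {i : ι} {S : Finset ι} (hi : i ∉ S) :
    Fintype.card ι = S.card + 1 + (rest i S).card := by
  have := sum_split hi fun _ => 1
  simpa using this

lemma mem_critSet {a : ι → ℕ} {i : ι} : i ∈ critSet ι a ↔
    (univ.filter fun k => a i < a k).card = Fintype.card ι - 1 - a i ∧ ∀ k, a i < a k → k < i := by
  simp [critSet]

lemma critSet_decompose {a : ι → ℕ} {i : ι} {S : Finset ι} (ha : Parking ι a)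
    (hi : i ∈ critSet ι a) (hS : univ.filter (fun k => a k < a i) = S) :
    i ∉ S ∧ a i = S.card ∧ Parking {k // k ∈ S} (fun k => a k) ∧
      (∀ k ∈ rest i S, S.card < a k) ∧
      Parking {k // k ∈ rest i S} (fun k => a k - (S.card + 1)) := by
  have hmem : ∀ k, k ∈ S ↔ a k < a i := fun k => by simp [← hS]
  have hiS : i ∉ S := by simp [hmem]
  have hlt := ha.lt i
  obtain ⟨hcrit, -⟩ := mem_critSet.1 hi
  have hle : (univ.filter fun k => a k ≤ a i).card = a i + 1 := by
    have := Finset.card_filter_add_card_filter_not (s := (univ : Finset ι)) fun k => a k ≤ a i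
    simp only [not_le, Finset.card_univ] at this
    omega
  have hsub : insert i S ⊆ univ.filter fun k => a k ≤ a i := by
    intro k hk
    rcases mem_insert.1 hk with rfl | hk
    · simp
    · simpa using ((hmem k).1 hk).le
  have hcardS : a i = S.card := by
    have h1 := card_le_card hsub
    rw [hle, card_insert_of_notMem hiS] at h1
    refine le_antisymm ?_ (by omega)
    rcases Nat.eq_zero_or_pos (a i) with h0 | h0
    · omega
    · have h2 := ha (a i - 1) (by omega)
      have h3 : univ.filter (fun k => a k ≤ a i - 1) ⊆ S := fun k hk => by
        have := (mem_filter.1 hk).2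
        exact (hmem k).2 (by omega)
      have := card_le_card h3
      omega
  have heq : insert i S = univ.filter fun k => a k ≤ a i :=
    eq_of_subset_of_card_le hsub (by rw [hle, card_insert_of_notMem hiS, hcardS])
  have hrest : ∀ k ∈ rest i S, S.card < a k := fun k hk => by
    by_contra! h
    have h1 : k ∈ insert i S := heq ▸ mem_filter.2 ⟨mem_univ _, by omega⟩
    have h2 := mem_rest.1 hk
    rcases mem_insert.1 h1 with h | h
    · exact h2.2 h
    · exact h2.1 h
  refine ⟨hiS, hcardS, fun j hj => ?_, hrest, fun j hj => ?_⟩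
  · rw [Fintype.card_coe] at hj
    change j < (univ.filter fun k : {k // k ∈ S} => a k ≤ j).card
    rw [card_filter_coe_eq (S := S) (a := a) fun k hk => (hmem k).2 (by omega)]
    exact ha j (by omega)
  · rw [Fintype.card_coe] at hj
    have hn := card_eq_split hiS
    have h1 := ha (S.card + 1 + j) (by omega)
    rw [card_split hiS, if_pos (by omega)] at h1
    have h2 : (univ.filter fun k : {k // k ∈ S} => a k ≤ S.card + 1 + j).card ≤ S.card :=
      (card_le_univ _).trans_eq (Fintype.card_coe S)
    have h3 : (univ.filter fun k : {k // k ∈ rest i S} => a k - (S.card + 1) ≤ j) =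
        univ.filter fun k : {k // k ∈ rest i S} => a k ≤ S.card + 1 + j := by
      ext k
      simp only [mem_filter, mem_univ, true_and]
      omega
    change j < (univ.filter fun k : {k // k ∈ rest i S} => a k - (S.card + 1) ≤ j).card
    rw [h3]
    omega

lemma critSet_compose {a : ι → ℕ} {i : ι} {S : Finset ι} (hiS : i ∉ S)
    (hmax : ∀ k, k ∉ S → k ≤ i) (hai : a i = S.card)
    (hP : Parking {k // k ∈ S} (fun k => a k)) (hrest : ∀ k ∈ rest i S, S.card < a k)
    (hQ : Parking {k // k ∈ rest i S} (fun k => a k - (S.card + 1))) :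
    Parking ι a ∧ i ∈ critSet ι a ∧ univ.filter (fun k => a k < a i) = S := by
  have hn := card_eq_split hiS
  have hlt : ∀ k ∈ S, a k < S.card := fun k hk => by
    simpa using hP.lt ⟨k, hk⟩
  have hmem : ∀ k, S.card < a k → k ∈ rest i S := fun k hk => by
    refine mem_rest.2 ⟨fun h => ?_, fun h => ?_⟩
    · have := hlt k h
      omega
    · subst h
      omega
  refine ⟨fun j hj => ?_, mem_critSet.2 ⟨?_, fun k hk => ?_⟩, ?_⟩
  · rw [card_split hiS]
    rcases lt_or_ge j S.card with h | h
    · have : j < (univ.filter fun k : {k // k ∈ S} => a k ≤ j).card :=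
        hP j (by rwa [Fintype.card_coe])
      omega
    · have h1 : (univ.filter fun k : {k // k ∈ S} => a k ≤ j) = univ :=
        Finset.filter_true_of_mem fun k _ => by
          have := hlt k k.2
          omega
      rw [h1, Finset.card_univ, Fintype.card_coe, if_pos (by omega)]
      rcases h.eq_or_lt with h | h
      · omega
      · have h2 := hQ (j - (S.card + 1)) (by rw [Fintype.card_coe]; omega)
        have h3 : (univ.filter fun k : {k // k ∈ rest i S} =>
            a k - (S.card + 1) ≤ j - (S.card + 1)) =
            univ.filter fun k : {k // k ∈ rest i S} => a k ≤ j := by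
          ext k
          simp only [mem_filter, mem_univ, true_and]
          omega
        rw [h3] at h2
        omega
  · have : univ.filter (fun k => a i < a k) = rest i S := by
      ext k
      simp only [mem_filter, mem_univ, true_and, hai]
      exact ⟨hmem k, hrest k⟩
    rw [this]
    omega
  · have h := mem_rest.1 (hmem k (by omega))
    exact lt_of_le_of_ne (hmax k h.1) h.2
  · ext k
    simp only [mem_filter, mem_univ, true_and, hai]
    refine ⟨fun h => ?_, hlt k⟩
    by_contra hk
    rcases eq_or_ne k i with rfl | hki
    · omega
    · have := hrest k (mem_rest.2 ⟨hk, hki⟩)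
      omega

lemma critSet_filter_gt {a : ι → ℕ} {i : ι} {S : Finset ι} (hiS : i ∉ S) (hai : a i = S.card)
    (hP : Parking {k // k ∈ S} (fun k => a k)) (hrest : ∀ k ∈ rest i S, S.card < a k) :
    ((critSet ι a).filter fun k => a i < a k).card =
      (critSet {k // k ∈ rest i S} fun k => a k - (S.card + 1)).card := by
  have hn := card_eq_split hiS
  have hmem : ∀ k, S.card < a k → k ∈ rest i S := fun k hk => by
    refine mem_rest.2 ⟨fun h => ?_, fun h => ?_⟩
    · have : a k < S.card := by simpa using hP.lt ⟨k, h⟩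
      omega
    · subst h
      omega
  rw [← card_map (Function.Embedding.subtype (· ∈ rest i S))]
  congr 1
  ext k
  simp only [mem_filter, mem_map, Function.Embedding.subtype_apply, Subtype.exists,
    exists_and_right, exists_eq_right]
  have key : ∀ hk : k ∈ rest i S, k ∈ critSet ι a ↔
      (⟨k, hk⟩ : {k // k ∈ rest i S}) ∈
        critSet {k // k ∈ rest i S} fun k => a k - (S.card + 1) := by
    intro hk
    have hak := hrest k hk
    rw [mem_critSet, mem_critSet]
    refine and_congr ?_ ?_
    · have h1 : (univ.filter fun l => a k < a l).card =
          (univ.filter fun l : {k // k ∈ rest i S} =>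
            a k - (S.card + 1) < a l - (S.card + 1)).card := by
        rw [← card_map (Function.Embedding.subtype (· ∈ rest i S))]
        congr 1
        ext l
        simp only [mem_filter, mem_univ, true_and, mem_map, Function.Embedding.subtype_apply,
          Subtype.exists, exists_and_right, exists_eq_right]
        refine ⟨fun h => ⟨hmem l (by omega), by omega⟩, fun ⟨hl, h⟩ => by omega⟩
      rw [h1, Fintype.card_coe]
      have : Fintype.card ι - 1 - a k = (rest i S).card - 1 - (a k - (S.card + 1)) := by omega
      rw [this]
    · refine ⟨fun h l hl => h l ?_, fun h l hl => h ⟨l, hmem l (by omega)⟩ ?_⟩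
      · change a k - (S.card + 1) < a l - (S.card + 1) at hl
        omega
      · change a k - (S.card + 1) < a l - (S.card + 1)
        omega
  constructor
  · rintro ⟨hk, h⟩
    have hk' := hmem k (by omega)
    exact ⟨hk', (key hk').1 hk⟩
  · rintro ⟨hk', hk⟩
    exact ⟨(key hk').2 hk, by have := hrest k hk'; omega⟩

lemma area_split {a : ι → ℕ} {i : ι} {S : Finset ι} (hiS : i ∉ S) (hai : a i = S.card)
    (hP : Parking {k // k ∈ S} (fun k => a k)) (hrest : ∀ k ∈ rest i S, S.card < a k)
    (hQ : Parking {k // k ∈ rest i S} (fun k => a k - (S.card + 1))) :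
    (Fintype.card ι).choose 2 - ∑ k, a k =
      (S.card.choose 2 - ∑ k : {k // k ∈ S}, a k) +
        ((rest i S).card.choose 2 - ∑ k : {k // k ∈ rest i S}, (a k - (S.card + 1))) := by
  have h1 := hP.sum_le
  have h2 := hQ.sum_le
  rw [Fintype.card_coe] at h1 h2
  have h3 : ∑ k : {k // k ∈ rest i S}, a k =
      ∑ k : {k // k ∈ rest i S}, (a k - (S.card + 1)) + (rest i S).card * (S.card + 1) := by
    have : (rest i S).card * (S.card + 1) = ∑ k : {k // k ∈ rest i S}, (S.card + 1) := by simp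
    rw [this, ← Finset.sum_add_distrib]
    refine Finset.sum_congr rfl fun k _ => ?_
    have := hrest k k.2
    omega
  rw [sum_split hiS, hai, h3, card_eq_split hiS, add_choose_two, add_choose_two]
  simp only [mul_one]
  have : (rest i S).card * (S.card + 1) = (S.card + 1) * (rest i S).card := mul_comm _ _
  have h0 : Nat.choose 1 2 = 0 := rfl
  omega

/-- Sums over a parking function and a critical maximum split off the smaller values. -/
lemma sum_critSet_fiber (x y : ℤ) (i : ι) (S : Finset ι) :
    ∑ a ∈ parkingFinset ι with i ∈ critSet ι a ∧ univ.filter (fun k => a k < a i) = S,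
      x ^ ((critSet ι a).filter fun k => a i < a k).card *
        y ^ ((Fintype.card ι).choose 2 - ∑ k, a k) =
    if i ∉ S ∧ ∀ k, k ∉ S → k ≤ i then
      parkSum {k // k ∈ S} 1 y * parkSum {k // k ∈ rest i S} x y else 0 := by
  split_ifs with h
  · obtain ⟨hiS, hmax⟩ := h
    rw [parkSum, parkSum, Finset.sum_mul_sum, ← Finset.sum_product']
    refine Finset.sum_bij' (fun a _ => (fun k => a k, fun k => a k - (S.card + 1)))
      (fun p _ k => if h : k ∈ S then p.1 ⟨k, h⟩ else if h : k ∈ rest i S then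
        p.2 ⟨k, h⟩ + (S.card + 1) else S.card) ?_ ?_ ?_ ?_ ?_
    · intro a ha
      simp only [mem_filter, mem_parkingFinset] at ha
      obtain ⟨-, -, hP, -, hQ⟩ := critSet_decompose ha.1 ha.2.1 ha.2.2
      simpa using ⟨hP, hQ⟩
    · rintro ⟨b, c⟩ hbc
      simp only [mem_product, mem_parkingFinset] at hbc
      simp only [mem_filter, mem_parkingFinset]
      have hr : ∀ k : {k // k ∈ rest i S}, (k : ι) ∉ S := fun k => (mem_rest.1 k.2).1
      refine critSet_compose hiS hmax ?_ ?_ (fun k hk => ?_) ?_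
      · simp [hiS, mem_rest]
      · simpa using hbc.1
      · simp only [(mem_rest.1 hk).1, hk, dite_true, dite_false]
        omega
      · simpa [hr] using hbc.2
    · intro a ha
      simp only [mem_filter, mem_parkingFinset] at ha
      obtain ⟨-, hai, -, hrest, -⟩ := critSet_decompose ha.1 ha.2.1 ha.2.2
      funext k
      by_cases hk : k ∈ S
      · simp [hk]
      · by_cases hk' : k ∈ rest i S
        · have := hrest k hk'
          simp only [hk, hk', dite_true, dite_false]
          omega
        · have : k = i := by simpa [mem_rest, hk] using hk'
          subst this
          simp [hk, hk', hai]
    · rintro ⟨b, c⟩ _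
      have hr : ∀ k : {k // k ∈ rest i S}, (k : ι) ∉ S := fun k => (mem_rest.1 k.2).1
      ext k
      · simp
      · simp [hr]
    · intro a ha
      simp only [mem_filter, mem_parkingFinset] at ha
      obtain ⟨-, hai, hP, hrest, hQ⟩ := critSet_decompose ha.1 ha.2.1 ha.2.2
      rw [critSet_filter_gt hiS hai hP hrest, area_split hiS hai hP hrest hQ]
      simp only [Fintype.card_coe, one_pow, one_mul, pow_add]
      ring
  · refine Finset.sum_eq_zero fun a ha => absurd ?_ h
    simp only [mem_filter, mem_parkingFinset] at ha
    obtain ⟨hiS, hai, -, hrest, -⟩ := critSet_decompose ha.1 ha.2.1 ha.2.2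
    refine ⟨hiS, fun k hk => ?_⟩
    rcases eq_or_ne k i with rfl | hki
    · exact le_rfl
    · have := hrest k (mem_rest.2 ⟨hk, hki⟩)
      exact ((mem_critSet.1 ha.2.1).2 k (by omega)).le

lemma critSet_injOn {a : ι → ℕ} (ha : Parking ι a) : Set.InjOn a (critSet ι a) := by
  intro i hi k _ hik
  by_contra hne
  obtain ⟨-, hai, -, hrest, -⟩ := critSet_decompose ha hi rfl
  have := hrest k (mem_rest.2 ⟨by simp [hik], Ne.symm hne⟩)
  omega

end CriticalMaxima

lemma pow_card_eq_sum_filter_gt (x : ℤ) (a : ι → ℕ) (C : Finset ι) (h : Set.InjOn a C) :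
    x ^ C.card = 1 + (x - 1) * ∑ i ∈ C, x ^ (C.filter fun k => a i < a k).card := by
  classical
  induction C using Finset.induction_on_min_value a with
  | empty => simp
  | insert i C hi hmin ih =>
    have ih := ih (h.mono (by simp))
    have hlt : ∀ k ∈ C, a i < a k := fun k hk => lt_of_le_of_ne (hmin k hk) fun hik =>
      hi (h (by simp) (by simp [hk]) hik ▸ hk)
    have h1 : (insert i C).filter (fun k => a i < a k) = C := by
      ext k
      simp only [mem_filter, mem_insert]
      refine ⟨?_, fun hk => ⟨.inr hk, hlt k hk⟩⟩
      rintro ⟨rfl | hk, h⟩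
      · omega
      · exact hk
    have h2 : ∀ j ∈ C, (insert i C).filter (fun k => a j < a k) = C.filter fun k => a j < a k := by
      intro j hj
      rw [Finset.filter_insert, if_neg (by have := hlt j hj; omega)]
    rw [Finset.card_insert_of_notMem hi, Finset.sum_insert hi, h1,
      Finset.sum_congr rfl fun j hj => by rw [h2 j hj], pow_succ]
    linear_combination (1 : ℤ) * ih

lemma parkSum_eq_add_sum [Fintype ι] [LinearOrder ι] (x y : ℤ) :
    parkSum ι x y = parkSum ι 1 y + (x - 1) * ∑ S : Finset ι, ∑ i,
      if i ∉ S ∧ ∀ k, k ∉ S → k ≤ i then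
        parkSum {k // k ∈ S} 1 y * parkSum {k // k ∈ rest i S} x y else 0 := by
  classical
  simp_rw [← sum_critSet_fiber]
  rw [Finset.sum_comm]
  have h1 : ∀ i : ι, ∑ S : Finset ι,
      (∑ a ∈ parkingFinset ι with i ∈ critSet ι a ∧ univ.filter (fun k => a k < a i) = S,
        x ^ ((critSet ι a).filter fun k => a i < a k).card *
          y ^ ((Fintype.card ι).choose 2 - ∑ k, a k)) =
      ∑ a ∈ parkingFinset ι with i ∈ critSet ι a,
        x ^ ((critSet ι a).filter fun k => a i < a k).card *
          y ^ ((Fintype.card ι).choose 2 - ∑ k, a k) := by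
    intro i
    rw [← Finset.sum_fiberwise _ fun a : ι → ℕ => univ.filter fun k => a k < a i]
    simp only [Finset.filter_filter]
  simp_rw [h1, Finset.sum_filter]
  rw [Finset.sum_comm, parkSum, parkSum, Finset.mul_sum, ← Finset.sum_add_distrib]
  refine Finset.sum_congr rfl fun a ha => ?_
  rw [← Finset.sum_filter, Finset.filter_mem_eq_inter, Finset.univ_inter, ← Finset.sum_mul,
    pow_card_eq_sum_filter_gt x a _ (critSet_injOn (mem_parkingFinset.1 ha))]
  ring

lemma parkSum_fin (n : ℕ) (x y : ℤ) :
    parkSum (Fin n) x y = parkSum (Fin n) 1 y + (x - 1) * ∑ k ∈ range n,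
      (n.choose k : ℤ) * (parkSum (Fin k) 1 y * parkSum (Fin (n - 1 - k)) x y) := by
  rw [parkSum_eq_add_sum]
  congr 2
  have h : ∀ S : Finset (Fin n), (∑ i, if i ∉ S ∧ ∀ k, k ∉ S → k ≤ i then
      parkSum {k // k ∈ S} 1 y * parkSum {k // k ∈ rest i S} x y else 0) =
      if S.card < n then
        parkSum (Fin S.card) 1 y * parkSum (Fin (n - 1 - S.card)) x y else 0 := by
    intro S
    split_ifs with hS
    · have hne : Sᶜ.Nonempty := by
        rw [← card_pos, card_compl, Fintype.card_fin]
        omega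
      have hmem : Sᶜ.max' hne ∉ S := mem_compl.1 (Sᶜ.max'_mem hne)
      have hmax : ∀ k, k ∉ S → k ≤ Sᶜ.max' hne := fun k hk => Sᶜ.le_max' k (mem_compl.2 hk)
      rw [Finset.sum_eq_single (Sᶜ.max' hne), if_pos ⟨hmem, hmax⟩, parkSum_coe, parkSum_coe]
      · have h1 := card_eq_split hmem
        rw [Fintype.card_fin] at h1
        have h2 : (rest (Sᶜ.max' hne) S).card = n - 1 - S.card := by omega
        rw [h2]
      · intro i _ hi
        refine if_neg fun h => hi (le_antisymm (hmax i h.1) (h.2 _ hmem))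
      · simp
    · refine Finset.sum_eq_zero fun i _ => if_neg fun h => ?_
      have := card_eq_split h.1
      rw [Fintype.card_fin] at this
      omega
  trans ∑ S : Finset (Fin n), if S.card < n then
    parkSum (Fin S.card) 1 y * parkSum (Fin (n - 1 - S.card)) x y else 0
  · refine Finset.sum_congr rfl fun S _ => ?_
    convert h S
  rw [← Finset.powerset_univ,
    Finset.sum_powerset_apply_card fun k => if k < n then
      parkSum (Fin k) 1 y * parkSum (Fin (n - 1 - k)) x y else 0,
    Finset.card_univ, Fintype.card_fin, Finset.sum_range_succ, if_neg (lt_irrefl n), smul_zero,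
    add_zero]
  exact Finset.sum_congr rfl fun k hk => by rw [if_pos (mem_range.1 hk), nsmul_eq_mul]

end ParkingFunction

section TutteComplete

open SimpleGraph ParkingFunction

lemma connSum_fin_succ {y : ℤ} (hy : y ≠ 0) (k : ℕ) :
    connSum (Fin (k + 1)) (y - 1) = (y - 1) ^ k * parkSum (Fin k) 1 y := by
  induction k using Nat.strong_induction_on with
  | _ n ih =>
    have h1 := graphSum_fin_succ n 1 (y - 1)
    simp only [graphSum_one, add_sub_cancel, one_mul] at h1
    rw [pow_choose_two_eq_sum hy, Finset.sum_range_succ, Finset.sum_range_succ,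
      Finset.sum_congr rfl fun k hk => by rw [← ih k (mem_range.1 hk)]] at h1
    simpa using (add_left_cancel h1).symm

lemma graphSum_eq_mul_parkSum {y : ℤ} (hy : y ≠ 0) (x : ℤ) (n : ℕ) :
    graphSum (Fin (n + 1)) ((x - 1) * (y - 1)) (y - 1) =
      (x - 1) * (y - 1) ^ (n + 1) * parkSum (Fin n) x y := by
  induction n using Nat.strong_induction_on with
  | _ n ih =>
    have h0 : graphSum (Fin 0) ((x - 1) * (y - 1)) (y - 1) = 1 := by
      simp [graphSum, numComp, numEdges]
    have h : ∀ k ∈ range n, (n.choose k : ℤ) * (connSum (Fin (k + 1)) (y - 1) *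
        ((x - 1) * (y - 1) * graphSum (Fin (n - k)) ((x - 1) * (y - 1)) (y - 1))) =
        (x - 1) * (y - 1) ^ (n + 1) * ((x - 1) * ((n.choose k : ℤ) *
          (parkSum (Fin k) 1 y * parkSum (Fin (n - 1 - k)) x y))) := by
      intro k hk
      obtain ⟨m, rfl⟩ := Nat.exists_eq_add_of_lt (mem_range.1 hk)
      rw [show k + m + 1 - k = m + 1 by omega, show k + m + 1 - 1 - k = m by omega,
        ih m (by omega), connSum_fin_succ hy]
      ring
    rw [graphSum_fin_succ, Finset.sum_range_succ, Finset.sum_congr rfl h, ← Finset.mul_sum,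
      ← Finset.mul_sum, parkSum_fin n x y, connSum_fin_succ hy, Nat.sub_self, h0, Nat.choose_self]
    push_cast
    ring

lemma eq_of_forall_two_le {f g : ℤ → ℤ} (hf : ∃ p : Polynomial ℤ, ∀ t, f t = p.eval t)
    (hg : ∃ p : Polynomial ℤ, ∀ t, g t = p.eval t) (h : ∀ t, 2 ≤ t → f t = g t) (t : ℤ) :
    f t = g t := by
  obtain ⟨p, hp⟩ := hf
  obtain ⟨q, hq⟩ := hg
  have : p = q := Polynomial.eq_of_infinite_eval_eq p q <| (Set.Ici_infinite (2 : ℤ)).mono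
    fun t ht => by simpa only [Set.mem_ofPred_eq, hp, hq] using h t ht
  rw [hp, hq, this]

lemma tutteK_eq_parkSum (n : ℕ) (x y : ℤ) : tutteK n x y = parkSum (Fin n) x y := by
  refine eq_of_forall_two_le (f := fun x => tutteK n x y) (g := fun x => parkSum (Fin n) x y)
    ?_ ?_ (fun x hx => eq_of_forall_two_le (f := tutteK n x) (g := parkSum (Fin n) x)
      ?_ ?_ (fun y hy => ?_) y) x
  · refine ⟨∑ A : Finset ↥(⊤ : SimpleGraph (Fin (n + 1))).edgeFinset,
      (Polynomial.X - 1) ^ (rk ((univ : Finset ↥(⊤ : SimpleGraph (Fin (n + 1))).edgeFinset).val.map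
        Subtype.val) - rk (A.val.map Subtype.val)) *
        Polynomial.C ((y - 1) ^ (A.card - rk (A.val.map Subtype.val))), fun t => ?_⟩
    simp [tutteK, _root_.tutte, Polynomial.eval_finsetSum]
  · refine ⟨∑ a ∈ parkingFinset (Fin n), Polynomial.X ^ (critSet (Fin n) a).card *
      Polynomial.C (y ^ ((Fintype.card (Fin n)).choose 2 - ∑ i, a i)), fun t => ?_⟩
    simp [parkSum, Polynomial.eval_finsetSum]
  · refine ⟨∑ A : Finset ↥(⊤ : SimpleGraph (Fin (n + 1))).edgeFinset,
      Polynomial.C ((x - 1) ^ (rk ((univ : Finset ↥(⊤ : SimpleGraph (Fin (n + 1))).edgeFinset).val.map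
        Subtype.val) - rk (A.val.map Subtype.val))) *
        (Polynomial.X - 1) ^ (A.card - rk (A.val.map Subtype.val)), fun t => ?_⟩
    simp [tutteK, _root_.tutte, Polynomial.eval_finsetSum]
  · refine ⟨∑ a ∈ parkingFinset (Fin n), Polynomial.C (x ^ (critSet (Fin n) a).card) *
      Polynomial.X ^ ((Fintype.card (Fin n)).choose 2 - ∑ i, a i), fun t => ?_⟩
    simp [parkSum, Polynomial.eval_finsetSum]
  · have h := (mul_tutteK n x y).trans (graphSum_eq_mul_parkSum (by omega) x n)
    exact mul_left_cancel₀ (mul_ne_zero (by omega) (pow_ne_zero _ (by omega))) h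

end TutteComplete

open scoped Classical in
/-- the Tutte polynomial of the complete graph `K_{n+1}` equals the
generating function of classical parking functions by number of critical maxima and
complemented sum. -/
theorem tutte_complete_parking (n : ℕ) (x y : ℤ) :
    tutteK n x y =
      ∑ a ∈ Finset.univ.filter (fun a : Fin n → Fin n => IsPF n (fun i => (a i : ℕ))),
        x ^ cm n (fun i => (a i : ℕ)) * y ^ (n.choose 2 - ∑ i, (a i : ℕ)) := by
  rw [tutteK_eq_parkSum, ParkingFunction.parkSum]
  refine (Finset.sum_bij (fun a _ i => (a i : ℕ)) (fun a ha => ?_) (fun a _ b _ h => ?_)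
    (fun a ha => ?_) fun a _ => ?_).symm
  · exact ParkingFunction.mem_parkingFinset.2
      ((ParkingFunction.isPF_iff_parking n _).1 (mem_filter.1 ha).2)
  · funext i
    exact Fin.ext (congrFun h i)
  · have h := ParkingFunction.mem_parkingFinset.1 ha
    refine ⟨fun i => ⟨a i, by simpa using h.lt i⟩, ?_, rfl⟩
    exact mem_filter.2 ⟨mem_univ _, (ParkingFunction.isPF_iff_parking n _).2 h⟩
  · rw [ParkingFunction.cm_eq_card_critSet, Fintype.card_fin]
end

section
/- Specializing at x = 1, y = 1 the identity Σ_α y^{C(n,2) - Σ a_i} over classical parking functions: the generating function Σ_{α ∈ P_n} q^{C(n,2) - Σ_{i=1}^n a_i} equals the spanning-tree inversion enumerator of K_{n+1}, i.e., T_{K_{n+1}}(1,q). -/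
open Finset

theorem choose_two_split {u k : ℕ} (h : k ≤ u) :
    (u + 1).choose 2 = (k + 1).choose 2 + (k + 1) * (u - k) + (u - k).choose 2 := by
  obtain ⟨d, rfl⟩ := Nat.exists_eq_add_of_le h
  rw [Nat.add_sub_cancel_left, show k + d + 1 = (k + 1) + d by ring, Nat.add_choose_eq]
  simp [Finset.Nat.antidiagonal_succ]
  ring

section Parking

variable {V : Type}

/-- `a` restricts to a parking function on `K`: for `j < #K` at least `j + 1` values are `≤ j`. -/
def ParkingOn (K : Finset V) (a : V → ℕ) : Prop :=
  ∀ j < #K, j + 1 ≤ #{v ∈ K | a v ≤ j}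

theorem ParkingOn.lt_card {K : Finset V} {a : V → ℕ} (h : ParkingOn K a) {v : V} (hv : v ∈ K) :
    a v < #K := by
  have hpos : 0 < #K := card_pos.2 ⟨v, hv⟩
  have h1 := h (#K - 1) (by omega)
  have h2 : ({v ∈ K | a v ≤ #K - 1} : Finset V) = K :=
    eq_of_subset_of_card_le (filter_subset _ _) (by omega)
  have h3 := (mem_filter.1 (h2.symm ▸ hv : v ∈ ({v ∈ K | a v ≤ #K - 1} : Finset V))).2
  omega

theorem ParkingOn.congr {K : Finset V} {a b : V → ℕ} (hab : ∀ v ∈ K, a v = b v) :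
    ParkingOn K a ↔ ParkingOn K b := by
  have : ∀ j, ({v ∈ K | a v ≤ j} : Finset V) = {v ∈ K | b v ≤ j} := fun j =>
    filter_congr fun v hv => by rw [hab v hv]
  simp only [ParkingOn, this]

variable [DecidableEq V]

theorem ParkingOn.insert {K : Finset V} {a : V → ℕ} (h : ParkingOn K a) {v : V} (hv : v ∉ K)
    (hav : a v ≤ #K) : ParkingOn (insert v K) a := by
  intro j hj
  rw [card_insert_of_notMem hv] at hj
  rcases Nat.lt_or_ge j #K with hjK | hjK
  · exact (h j hjK).trans (card_le_card (filter_subset_filter _ (subset_insert _ _)))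
  · have hall : ({w ∈ Insert.insert v K | a w ≤ j} : Finset V) = Insert.insert v K :=
      filter_true_of_mem fun w hw => by
        rcases mem_insert.1 hw with rfl | hw
        · omega
        · exact (h.lt_card hw).le.trans hjK
    rw [hall, card_insert_of_notMem hv]
    omega

/-- Every function on `U` has a unique maximal parking part. -/
theorem existsUnique_parkingOn (U : Finset V) (a : V → ℕ) :
    ∃! K, K ∈ U.powerset ∧ ParkingOn K a ∧ ∀ v ∈ U \ K, #K < a v := by
  classical
  obtain ⟨K, hK, hmax⟩ := exists_max_image (U.powerset.filter fun K => ParkingOn K a) card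
    ⟨∅, by simp [ParkingOn]⟩
  rw [mem_filter, mem_powerset] at hK
  have key : ∀ K L : Finset V, L ⊆ U → ParkingOn L a →
      (∀ v ∈ U \ K, #K < a v) → L ⊆ K := by
    intro K L hLU hL hKa
    have hin : ∀ v ∈ L, a v ≤ #K → v ∈ K := fun v hv hav => by
      by_contra hvK
      exact absurd (hKa v (mem_sdiff.2 ⟨hLU hv, hvK⟩)) (by omega)
    have hcard : #L ≤ #K := by
      by_contra! hlt
      have h1 := hL _ hlt
      have h2 : #{v ∈ L | a v ≤ #K} ≤ #K := card_le_card fun v hv =>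
        hin v (mem_filter.1 hv).1 (mem_filter.1 hv).2
      omega
    exact fun v hv => hin v hv ((hL.lt_card hv).le.trans hcard)
  refine ⟨K, ⟨mem_powerset.2 hK.1, hK.2, fun v hv => ?_⟩, fun L hL => ?_⟩
  · rw [mem_sdiff] at hv
    by_contra! hle
    have := hmax (insert v K) (mem_filter.2 ⟨mem_powerset.2 (insert_subset hv.1 hK.1),
      hK.2.insert hv.2 hle⟩)
    rw [card_insert_of_notMem hv.2] at this
    omega
  · have hKL := key L K hK.1 hK.2 hL.2.2
    exact (eq_of_subset_of_card_le hKL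
      (hmax L (mem_filter.2 ⟨hL.1, hL.2.1⟩))).symm

variable [Fintype V]

/-- Functions with values in `{0, …, N}` supported on `K`. -/
def boxOn (N : ℕ) (K : Finset V) : Finset (V → ℕ) :=
  Fintype.piFinset fun v => if v ∈ K then range (N + 1) else {0}

theorem mem_boxOn {N : ℕ} {K : Finset V} {a : V → ℕ} :
    a ∈ boxOn N K ↔ (∀ v ∈ K, a v ≤ N) ∧ ∀ v ∉ K, a v = 0 := by
  simp only [boxOn, Fintype.mem_piFinset]
  constructor
  · intro h
    refine ⟨fun v hv => ?_, fun v hv => ?_⟩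
    · have := h v
      rw [if_pos hv, mem_range] at this
      omega
    · simpa [hv] using h v
  · rintro ⟨h1, h2⟩ v
    split_ifs with hv
    · exact mem_range.2 (Nat.lt_succ_of_le (h1 v hv))
    · exact mem_singleton.2 (h2 v hv)

theorem sum_boxOn_union {M : Type*} [AddCommMonoid M] (N : ℕ) {K L : Finset V} (h : Disjoint K L)
    (f : (V → ℕ) → M) :
    ∑ a ∈ boxOn N (K ∪ L), f a = ∑ p ∈ boxOn N K ×ˢ boxOn N L, f (p.1 + p.2) := by
  symm
  have hd := disjoint_left.1 h
  refine sum_nbij' (fun p => p.1 + p.2)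
    (fun a => (fun v => if v ∈ K then a v else 0, fun v => if v ∈ L then a v else 0))
    ?_ ?_ ?_ ?_ ?_
  · rintro ⟨b, c⟩ hbc
    simp only [mem_product, mem_boxOn, Pi.add_apply, mem_union] at hbc ⊢
    grind
  · intro a ha
    simp only [mem_product, mem_boxOn, mem_union] at ha ⊢
    grind
  · rintro ⟨b, c⟩ hbc
    simp only [mem_product, mem_boxOn] at hbc
    ext v <;> simp only [Pi.add_apply] <;> grind
  · intro a ha
    simp only [mem_boxOn, mem_union] at ha
    ext v
    simp only [Pi.add_apply]
    grind
  · intros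
    rfl

variable {R : Type} [CommRing R]

theorem sum_boxOn_prod (N : ℕ) (L : Finset V) (g : ℕ → R) :
    ∑ a ∈ boxOn N L, ∏ v ∈ L, g (a v) = (∑ j ∈ range (N + 1), g j) ^ #L := by
  have h := prod_univ_sum (fun v => if v ∈ L then range (N + 1) else {0})
    (fun v j => if v ∈ L then g j else (1 : R))
  have h1 : ∀ v, ∑ j ∈ (if v ∈ L then range (N + 1) else {0}), (if v ∈ L then g j else (1 : R)) =
      if v ∈ L then ∑ j ∈ range (N + 1), g j else 1 := by
    intro v
    split_ifs <;> simp
  simp only [h1, prod_ite_mem, univ_inter, prod_const] at h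
  exact h.symm

/-- The weight of the value `j`: these telescope to `∑ j ≥ m, q ^ (N - m)`. -/
def parkWeight (N : ℕ) (q : R) (j : ℕ) : R :=
  if j < N then (q - 1) * q ^ (N - 1 - j) else 1

theorem sum_parkWeight (N : ℕ) (q : R) {m : ℕ} (hm : m ≤ N) :
    ∑ j ∈ range (N + 1), (if m ≤ j then parkWeight N q j else 0) = q ^ (N - m) := by
  induction hm using Nat.decreasingInduction with
  | self =>
    rw [sum_eq_single N]
    · simp [parkWeight]
    · intro j hj hjN
      rw [if_neg]
      have := mem_range.1 hj
      omega
    · simp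
  | of_succ m hm ih =>
    have : ∀ j, (if m ≤ j then parkWeight N q j else 0) =
        (if m + 1 ≤ j then parkWeight N q j else 0) + if m = j then parkWeight N q j else 0 := by
      intro j
      rcases lt_trichotomy m j with h | h | h
      · simp [h.le, h.ne, Nat.succ_le_of_lt h]
      · simp [h]
      · simp [h.not_ge, h.ne', show ¬ m + 1 ≤ j by omega]
    simp only [this, sum_add_distrib, ih, sum_ite_eq, mem_range]
    rw [if_pos (by omega), parkWeight, if_pos (by omega)]
    obtain ⟨d, rfl⟩ := Nat.exists_eq_add_of_lt hm
    rw [show m + d + 1 - (m + 1) = d by omega, show m + d + 1 - 1 - m = d by omega,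
      show m + d + 1 - m = d + 1 by omega]
    ring

open scoped Classical in
/-- The weighted sum over parking functions on `K`. -/
noncomputable def parkSum (N : ℕ) (q : R) (K : Finset V) : R :=
  ∑ a ∈ boxOn N K with ParkingOn K a, ∏ v ∈ K, parkWeight N q (a v)

theorem parkSum_recursion (N : ℕ) (q : R) (U : Finset V) (hU : #U ≤ N) :
    q ^ (N * #U) =
      ∑ K ∈ U.powerset, parkSum N q K * q ^ ((N - (#K + 1)) * (#U - #K)) := by
  classical
  have htot : ∑ a ∈ boxOn N U, ∏ v ∈ U, parkWeight N q (a v) = q ^ (N * #U) := by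
    rw [sum_boxOn_prod, pow_mul]
    simpa using congrArg (· ^ #U) (sum_parkWeight N q (Nat.zero_le N))
  have hpart : ∀ a : V → ℕ, ∑ K ∈ U.powerset,
      (if ParkingOn K a ∧ ∀ v ∈ U \ K, #K < a v then (1 : R) else 0) = 1 := by
    intro a
    obtain ⟨K, hK, huniq⟩ := existsUnique_parkingOn U a
    rw [sum_eq_single_of_mem K hK.1, if_pos hK.2]
    intro L hL hne
    exact if_neg fun h => hne (huniq L ⟨hL, h⟩)
  rw [← htot]
  calc _ = ∑ a ∈ boxOn N U, ∑ K ∈ U.powerset,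
        (if ParkingOn K a ∧ ∀ v ∈ U \ K, #K < a v then (1 : R) else 0) *
          ∏ v ∈ U, parkWeight N q (a v) := by
        refine sum_congr rfl fun a _ => ?_
        rw [← sum_mul, hpart, one_mul]
    _ = _ := by
        rw [sum_comm]
        refine sum_congr rfl fun K hK => ?_
        have hKU := mem_powerset.1 hK
        have hd : Disjoint K (U \ K) := disjoint_sdiff
        have hbox : boxOn N U = boxOn N (K ∪ U \ K) := by rw [union_sdiff_of_subset hKU]
        have hR : q ^ ((N - (#K + 1)) * (#U - #K)) =
            ∑ c ∈ boxOn N (U \ K), ∏ v ∈ U \ K,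
              (if #K + 1 ≤ c v then parkWeight N q (c v) else 0) := by
          rw [sum_boxOn_prod N (U \ K) fun j => if #K + 1 ≤ j then parkWeight N q j else 0,
            card_sdiff_of_subset hKU, pow_mul]
          rcases (card_le_card hKU).eq_or_lt with h | h
          · simp [h]
          · rw [sum_parkWeight N q (by omega)]
        rw [hbox, sum_boxOn_union N hd, hR, parkSum, sum_filter, sum_mul_sum, ← sum_product']
        refine sum_congr rfl fun p hp => ?_
        rw [mem_product, mem_boxOn, mem_boxOn] at hp
        have h1 : ∀ v ∈ K, (p.1 + p.2) v = p.1 v := fun v hv => by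
          simp [hp.2.2 v (by simp [hv])]
        have h2 : ∀ v ∈ U \ K, (p.1 + p.2) v = p.2 v := fun v hv => by
          simp [hp.1.2 v (mem_sdiff.1 hv).2]
        have hprod : ∏ v ∈ U, parkWeight N q ((p.1 + p.2) v) =
            (∏ v ∈ K, parkWeight N q (p.1 v)) * ∏ v ∈ U \ K, parkWeight N q (p.2 v) := by
          rw [← prod_sdiff hKU, mul_comm]
          congr 1
          · exact prod_congr rfl fun v hv => by rw [h1 v hv]
          · exact prod_congr rfl fun v hv => by rw [h2 v hv]
        rw [hprod, ParkingOn.congr h1]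
        have hall : (∀ v ∈ U \ K, #K < (p.1 + p.2) v) ↔ ∀ v ∈ U \ K, #K + 1 ≤ p.2 v :=
          forall₂_congr fun v hv => by rw [h2 v hv, Nat.succ_le_iff]
        simp only [hall]
        rw [prod_ite_zero]
        split_ifs <;> first | (exfalso; tauto) | ring

end Parking

section ConnectedSubgraphs

variable {V : Type}

/-- `v` can be reached from `r` along edges of `A`. -/
def EdgeReach (A : Finset (Sym2 V)) (r v : V) : Prop :=
  Relation.ReflTransGen (fun x y => s(x, y) ∈ A) r v

theorem EdgeReach.mono {A B : Finset (Sym2 V)} (h : A ⊆ B) {r v : V} (hr : EdgeReach A r v) :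
    EdgeReach B r v :=
  Relation.ReflTransGen.mono (fun _ _ hxy => h hxy) _ _ hr

theorem EdgeReach.mem_of_closed {A : Finset (Sym2 V)} {r v : V} {S : Finset V}
    (h : EdgeReach A r v) (hr : r ∈ S) (hS : ∀ x ∈ S, ∀ y, s(x, y) ∈ A → y ∈ S) : v ∈ S := by
  induction h with
  | refl => exact hr
  | tail _ hxy ih => exact hS _ ih _ hxy

variable [DecidableEq V]

/-- The edges of the complete graph on `S`. -/
def edgesOn (S : Finset V) : Finset (Sym2 V) :=
  S.offDiag.image fun p => s(p.1, p.2)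

theorem mk_mem_edgesOn {S : Finset V} {v w : V} :
    s(v, w) ∈ edgesOn S ↔ v ∈ S ∧ w ∈ S ∧ v ≠ w := by
  simp only [edgesOn, mem_image, mem_offDiag, Prod.exists, Sym2.eq_iff]
  grind

theorem card_edgesOn (S : Finset V) : #(edgesOn S) = (#S).choose 2 :=
  Sym2.card_image_offDiag S

theorem edgesOn_mono {S T : Finset V} (h : S ⊆ T) : edgesOn S ⊆ edgesOn T :=
  image_subset_image (offDiag_mono h)

variable {R : Type} [CommRing R]

theorem sum_powerset_edgesOn (q : R) (S : Finset V) :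
    ∑ A ∈ (edgesOn S).powerset, (q - 1) ^ #A = q ^ (#S).choose 2 := by
  have := sum_pow_mul_eq_add_pow (q - 1) 1 (edgesOn S)
  simpa [card_edgesOn] using this

variable [Fintype V]

open scoped Classical in
/-- The vertices other than `r` that are reachable from `r`. -/
noncomputable def reachSet (r : V) (A : Finset (Sym2 V)) : Finset V :=
  {v | v ≠ r ∧ EdgeReach A r v}

theorem mem_insert_reachSet {r v : V} {A : Finset (Sym2 V)} :
    v ∈ insert r (reachSet r A) ↔ EdgeReach A r v := by
  by_cases h : v = r
  · simp only [h, mem_insert_self, true_iff]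
    exact Relation.ReflTransGen.refl
  · simp [reachSet, h]

theorem reachSet_eq_iff {r : V} {A : Finset (Sym2 V)} {K : Finset V} (hr : r ∉ K) :
    reachSet r A = K ↔ ∀ v, EdgeReach A r v ↔ v ∈ insert r K := by
  simp only [← mem_insert_reachSet]
  constructor
  · rintro rfl v
    rfl
  · intro h
    have hr' : r ∉ reachSet r A := by simp [reachSet]
    rw [← erase_insert hr', ext h, erase_insert hr]

/-- The weighted sum over connected graphs with vertex set `insert r K`. -/
noncomputable def connSum (q : R) (r : V) (K : Finset V) : R :=
  ∑ A ∈ (edgesOn (insert r K)).powerset with reachSet r A = K, (q - 1) ^ #A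

theorem connSum_recursion (q : R) (r : V) (U : Finset V) (hr : r ∉ U) :
    q ^ (#U + 1).choose 2 =
      ∑ K ∈ U.powerset, connSum q r K * q ^ (#U - #K).choose 2 := by
  rw [← card_insert_of_notMem hr, ← sum_powerset_edgesOn]
  have hmaps : ∀ A ∈ (edgesOn (insert r U)).powerset, reachSet r A ∈ U.powerset := by
    intro A hA
    rw [mem_powerset] at hA ⊢
    intro v hv
    have h1 : EdgeReach A r v := mem_insert_reachSet.1 (mem_insert_of_mem hv)
    have h2 : v ∈ insert r U := h1.mem_of_closed (mem_insert_self _ _)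
      fun x _ y hxy => (mk_mem_edgesOn.1 (hA hxy)).2.1
    have h3 : v ≠ r := by
      classical
      simpa [reachSet] using fun h => (mem_filter.1 hv).2.1 h
    exact mem_of_mem_insert_of_ne h2 h3
  rw [← sum_fiberwise_of_maps_to hmaps]
  refine sum_congr rfl fun K hK => ?_
  have hKU := mem_powerset.1 hK
  have hrK : r ∉ K := fun h => hr (hKU h)
  rw [← card_sdiff_of_subset hKU, ← sum_powerset_edgesOn, connSum, sum_mul_sum, ← sum_product']
  symm
  have hdisj : Disjoint (edgesOn (insert r K)) (edgesOn (U \ K)) := by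
    rw [disjoint_left]
    intro e
    induction e with
    | _ x y =>
      simp only [mk_mem_edgesOn, mem_insert, mem_sdiff]
      grind
  refine sum_nbij' (fun p => p.1 ∪ p.2)
    (fun A => (A ∩ edgesOn (insert r K), A ∩ edgesOn (U \ K))) ?_ ?_ ?_ ?_ ?_
  · rintro ⟨B, D⟩ h
    simp only [mem_product, mem_filter, mem_powerset] at h ⊢
    obtain ⟨⟨hB, hBK⟩, hD⟩ := h
    rw [reachSet_eq_iff hrK] at hBK ⊢
    refine ⟨union_subset (hB.trans (edgesOn_mono (insert_subset_insert _ hKU)))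
      (hD.trans (edgesOn_mono (sdiff_subset.trans (subset_insert _ _)))), fun v => ⟨fun h => ?_,
      fun h => ((hBK v).2 h).mono subset_union_left⟩⟩
    refine h.mem_of_closed (mem_insert_self _ _) fun x hx y hxy => ?_
    rcases mem_union.1 hxy with hxy | hxy
    · exact (mk_mem_edgesOn.1 (hB hxy)).2.1
    · have := (mk_mem_edgesOn.1 (hD hxy)).1
      grind
  · intro A h
    simp only [mem_product, mem_filter, mem_powerset] at h ⊢
    obtain ⟨hA, hAK⟩ := h
    refine ⟨⟨inter_subset_right, ?_⟩, inter_subset_right⟩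
    rw [reachSet_eq_iff hrK] at hAK ⊢
    refine fun v => ⟨fun h => (hAK v).1 (h.mono inter_subset_left), fun hv => ?_⟩
    have hv' := (hAK v).2 hv
    clear hv
    induction hv' with
    | refl => exact Relation.ReflTransGen.refl
    | @tail x y hx hxy ih =>
      refine Relation.ReflTransGen.tail ih (mem_inter.2 ⟨hxy, mk_mem_edgesOn.2
        ⟨(hAK x).1 hx, (hAK y).1 (hx.tail hxy), (mk_mem_edgesOn.1 (hA hxy)).2.2⟩⟩)
  · rintro ⟨B, D⟩ h
    simp only [mem_product, mem_filter, mem_powerset] at h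
    obtain ⟨⟨hB, -⟩, hD⟩ := h
    have h1 := disjoint_of_subset_left hB hdisj
    have h2 := (disjoint_of_subset_right hD hdisj).symm
    simp only [union_inter_distrib_right, inter_eq_left.2 hB, inter_eq_left.2 hD,
      disjoint_iff_inter_eq_empty.1 h1, disjoint_iff_inter_eq_empty.1 h2, union_empty, empty_union]
  · intro A h
    simp only [mem_filter, mem_powerset] at h
    obtain ⟨hA, hAK⟩ := h
    rw [reachSet_eq_iff hrK] at hAK
    rw [← inter_union_distrib_left, inter_eq_left]
    intro e
    induction e with
    | _ x y =>
      intro hxy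
      have hxy' : s(y, x) ∈ A := Sym2.eq_swap ▸ hxy
      have hU := mk_mem_edgesOn.1 (hA hxy)
      have h1 : x ∈ insert r K → y ∈ insert r K := fun hx =>
        (hAK y).1 (((hAK x).2 hx).tail hxy)
      have h2 : y ∈ insert r K → x ∈ insert r K := fun hy =>
        (hAK x).1 (((hAK y).2 hy).tail hxy')
      simp only [mem_union, mk_mem_edgesOn, mem_insert, mem_sdiff] at *
      grind
  · rintro ⟨B, D⟩ h
    simp only [mem_product, mem_filter, mem_powerset] at h
    rw [card_union_of_disjoint (disjoint_of_subset_left h.1.1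
      (disjoint_of_subset_right h.2 hdisj)), pow_add]

theorem parkSum_eq_connSum (N : ℕ) (q : R) (r : V) (U : Finset V) (hr : r ∉ U) (hU : #U ≤ N) :
    parkSum N q U * q ^ (#U + 1).choose 2 = connSum q r U * q ^ (N * #U) := by
  induction U using Finset.strongInduction with
  | H U ih =>
    have h1 := congrArg (· * q ^ (#U + 1).choose 2) (parkSum_recursion N q U hU)
    have h2 := congrArg (· * q ^ (N * #U)) (connSum_recursion q r U hr)
    simp only [sum_mul] at h1 h2
    rw [mul_comm, h2] at h1
    rw [← sum_erase_add _ _ (mem_powerset_self U), ← sum_erase_add _ _ (mem_powerset_self U)] at h1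
    have h3 : ∀ K ∈ U.powerset.erase U,
        connSum q r K * q ^ (#U - #K).choose 2 * q ^ (N * #U) =
          parkSum N q K * q ^ ((N - (#K + 1)) * (#U - #K)) * q ^ (#U + 1).choose 2 := by
      intro K hK
      rw [mem_erase, mem_powerset] at hK
      have hss : K ⊂ U := hK.2.ssubset_of_ne hK.1
      have hlt := card_lt_card hss
      have hi := ih K hss (fun h => hr (hK.2 h)) (hlt.le.trans hU)
      have hNU : N * #U = N * #K + N * (#U - #K) := by
        rw [← mul_add, Nat.add_sub_cancel' hlt.le]
      have hN : N * (#U - #K) = (N - (#K + 1)) * (#U - #K) + (#K + 1) * (#U - #K) := by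
        rw [← add_mul, Nat.sub_add_cancel (by omega)]
      rw [choose_two_split hlt.le, hNU]
      calc _ = connSum q r K * q ^ (N * #K) * q ^ (N * (#U - #K)) *
            q ^ (#U - #K).choose 2 := by ring
        _ = _ := by
          rw [← hi, hN]
          ring
    rw [sum_congr rfl h3, add_right_inj] at h1
    simpa using h1.symm

end ConnectedSubgraphs

section Specialization

theorem isPF_iff_parkingOn {n : ℕ} {a : Fin n → ℕ} : IsPF n a ↔ ParkingOn univ a := by
  simp only [ParkingOn, card_univ, Fintype.card_fin]
  constructor
  · rintro ⟨σ, -, hσ⟩ j hj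
    calc j + 1 = #((Iic (⟨j, hj⟩ : Fin n)).map σ.toEmbedding) := by simp
      _ ≤ _ := card_le_card fun v hv => by
        obtain ⟨i, hi, rfl⟩ := mem_map.1 hv
        exact mem_filter.2 ⟨mem_univ _, (hσ i).trans (Fin.le_def.1 (mem_Iic.1 hi))⟩
  · intro h
    refine ⟨Tuple.sort a, Tuple.monotone_sort a, fun i => ?_⟩
    by_contra! hlt
    have h1 := h i i.2
    have h2 : #{v | a v ≤ i} ≤ #((Iio i).map (Tuple.sort a).toEmbedding) :=
      card_le_card fun v hv => by
        refine mem_map.2 ⟨(Tuple.sort a).symm v, mem_Iio.2 ?_, by simp⟩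
        by_contra! hle
        have h3 := Tuple.monotone_sort a hle
        simp only [Function.comp_apply, Equiv.apply_symm_apply] at h3 hlt
        have h4 := (mem_filter.1 hv).2
        omega
    simp only [card_map, Fin.card_Iio] at h2
    omega

theorem sum_le_choose_two_of_isPF {n : ℕ} {a : Fin n → ℕ} (h : IsPF n a) :
    ∑ i, a i ≤ n.choose 2 := by
  obtain ⟨σ, -, hσ⟩ := h
  rw [← Equiv.sum_comp σ, Nat.choose_two_right, ← sum_range_id, ← Fin.sum_univ_eq_sum_range]
  exact sum_le_sum fun i _ => hσ i

variable {R : Type} [CommRing R]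

theorem prod_parkWeight_of_lt {n : ℕ} (q : R) {a : Fin n → ℕ} (ha : ∀ i, a i < n)
    (hs : ∑ i, a i ≤ n.choose 2) :
    ∏ i, parkWeight n q (a i) =
      (q - 1) ^ n * q ^ (n.choose 2 - ∑ i, a i) * q ^ n.choose 2 := by
  have h1 : ∑ i, (n - 1 - a i) + ∑ i, a i = n * (n - 1) := by
    rw [← sum_add_distrib,
      sum_congr rfl fun i _ => Nat.sub_add_cancel (Nat.le_sub_one_of_lt (ha i))]
    simp
  have h2 : n.choose 2 + n.choose 2 = n * (n - 1) := by
    rw [← mul_two, Nat.choose_two_right, ← sum_range_id, sum_range_id_mul_two]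
  simp only [parkWeight, ha, if_true, prod_mul_distrib, prod_const, card_univ, Fintype.card_fin,
    prod_pow_eq_pow_sum]
  rw [mul_assoc, ← pow_add]
  congr 2
  omega

open scoped Classical in
/-- The generating function of classical parking functions by complemented sum. -/
noncomputable def parkEnum (n : ℕ) (q : R) : R :=
  ∑ a ∈ Finset.univ.filter (fun a : Fin n → Fin n => IsPF n (fun i => (a i : ℕ))),
    q ^ (n.choose 2 - ∑ i, (a i : ℕ))

theorem parkingOn_map_succ {n : ℕ} {b : Fin (n + 1) → ℕ} :
    ParkingOn (univ.map (Fin.succEmb n)) b ↔ IsPF n fun i => b i.succ := by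
  rw [isPF_iff_parkingOn]
  simp only [ParkingOn, filter_map, card_map]
  rfl

theorem parkSum_map_succ (n : ℕ) (q : R) :
    parkSum n q (univ.map (Fin.succEmb n)) =
      (q - 1) ^ n * parkEnum n q * q ^ n.choose 2 := by
  classical
  rw [parkEnum, mul_sum, sum_mul, parkSum]
  symm
  have hlt : ∀ b : Fin (n + 1) → ℕ, ParkingOn (univ.map (Fin.succEmb n)) b →
      ∀ i : Fin n, b i.succ < n := fun b hb i => by
    simpa using hb.lt_card (v := i.succ) (mem_map_of_mem (Fin.succEmb n) (mem_univ i))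
  refine sum_bij (fun a _ => Fin.cons 0 fun i => (a i : ℕ)) ?_ ?_ ?_ ?_
  · intro a ha
    rw [mem_filter] at ha
    rw [mem_filter, mem_boxOn, parkingOn_map_succ]
    refine ⟨⟨fun v hv => ?_, fun v hv => ?_⟩, by simpa using ha.2⟩
    · obtain ⟨i, -, rfl⟩ := mem_map.1 hv
      simp
    · refine Fin.cases (fun _ => by simp) (fun i hi => ?_) v hv
      exact absurd (mem_map_of_mem (Fin.succEmb n) (mem_univ i)) hi
  · intro a _ b _ hab
    ext i
    simpa using congrFun hab i.succ
  · intro b hb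
    rw [mem_filter, mem_boxOn] at hb
    refine ⟨fun i => ⟨b i.succ, hlt b hb.2 i⟩, ?_, ?_⟩
    · exact mem_filter.2 ⟨mem_univ _, parkingOn_map_succ.1 hb.2⟩
    · ext v
      refine Fin.cases ?_ (fun i => ?_) v
      · exact (hb.1.2 0 (by simp)).symm
      · simp
  · intro a ha
    rw [mem_filter] at ha
    rw [prod_map]
    simp only [Fin.coe_succEmb, Fin.cons_succ]
    exact (prod_parkWeight_of_lt q (fun i => (a i).2) (sum_le_choose_two_of_isPF ha.2)).symm

/-- The generating function of connected graphs on `Fin (n + 1)` by excess. -/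
noncomputable def connEnum (n : ℕ) (q : R) : R :=
  ∑ A ∈ (edgesOn (univ : Finset (Fin (n + 1)))).powerset with
    reachSet 0 A = univ.map (Fin.succEmb n), (q - 1) ^ (#A - n)

theorem insert_zero_map_succ (n : ℕ) :
    insert 0 (univ.map (Fin.succEmb n)) = (univ : Finset (Fin (n + 1))) := by
  ext v
  refine Fin.cases ?_ (fun i => ?_) v <;> simp

theorem reachable_mAdj_iff {V : Type} [DecidableEq V] {A : Finset (Sym2 V)}
    (hA : ∀ e ∈ A, ¬ e.IsDiag) (u v : V) : (mAdj A.val).Reachable u v ↔ EdgeReach A u v := by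
  have : (mAdj A.val).Adj = fun x y => s(x, y) ∈ A := by
    ext x y
    simp only [mAdj, SimpleGraph.fromRel_adj, mem_val]
    rw [Sym2.eq_swap (a := y), or_self, and_iff_right_iff_imp]
    intro h hxy
    exact hA _ h (by simpa using hxy)
  rw [SimpleGraph.reachable_iff_reflTransGen, this]
  rfl

theorem not_isDiag_of_mem_edgesOn {V : Type} [DecidableEq V] {S : Finset V} {e : Sym2 V}
    (he : e ∈ edgesOn S) : ¬ e.IsDiag := by
  induction e with
  | _ x y => simpa using (mk_mem_edgesOn.1 he).2.2

theorem connected_mAdj_iff {n : ℕ} {A : Finset (Sym2 (Fin (n + 1)))} (hA : A ⊆ edgesOn univ) :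
    (mAdj A.val).Connected ↔ reachSet 0 A = univ.map (Fin.succEmb n) := by
  have hd : ∀ e ∈ A, ¬ e.IsDiag := fun e he => not_isDiag_of_mem_edgesOn (hA he)
  rw [reachSet_eq_iff (by simp), insert_zero_map_succ,
    SimpleGraph.connected_iff_exists_forall_reachable]
  simp only [mem_univ, iff_true, ← reachable_mAdj_iff hd]
  exact ⟨fun ⟨u, hu⟩ v => (hu 0).symm.trans (hu v), fun h => ⟨0, h⟩⟩

theorem comps_pos {n : ℕ} (M : Multiset (Sym2 (Fin (n + 1)))) : 1 ≤ comps M := by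
  have : Nonempty (mAdj M).ConnectedComponent := ⟨(mAdj M).connectedComponentMk 0⟩
  exact Nat.card_pos

theorem comps_eq_one_iff {n : ℕ} (M : Multiset (Sym2 (Fin (n + 1)))) :
    comps M = 1 ↔ (mAdj M).Connected := by
  rw [comps, Nat.card_eq_one_iff_unique]
  constructor
  · rintro ⟨h, -⟩
    exact ⟨fun u v => SimpleGraph.ConnectedComponent.exact (Subsingleton.elim _ _)⟩
  · intro h
    exact ⟨h.preconnected.subsingleton_connectedComponent, ⟨(mAdj M).connectedComponentMk 0⟩⟩

theorem le_card_of_connected {n : ℕ} {A : Finset (Sym2 (Fin (n + 1)))}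
    (h : (mAdj A.val).Connected) : n ≤ #A := by
  have h1 := h.card_vert_le_card_edgeSet_add_one
  have h2 : (mAdj A.val).edgeSet ⊆ (A : Set (Sym2 (Fin (n + 1)))) := by
    intro e
    induction e with
    | _ x y =>
      simp only [mAdj, SimpleGraph.mem_edgeSet, SimpleGraph.fromRel_adj, mem_val, mem_coe]
      rw [Sym2.eq_swap (a := y), or_self]
      exact And.right
  have h3 := Nat.card_mono A.finite_toSet h2
  simp at h1 h3
  omega

theorem connSum_map_succ (n : ℕ) (q : R) :
    connSum q 0 (univ.map (Fin.succEmb n)) = (q - 1) ^ n * connEnum n q := by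
  rw [connSum, connEnum, mul_sum, insert_zero_map_succ]
  refine sum_congr rfl fun A hA => ?_
  rw [mem_filter, mem_powerset] at hA
  rw [← pow_add, Nat.add_sub_cancel' (le_card_of_connected ((connected_mAdj_iff hA.1).2 hA.2))]

theorem connEnum_eq_parkEnum_of_isDomain [IsDomain R] (n : ℕ) (q : R) (h0 : q ≠ 0)
    (h1 : q ≠ 1) : connEnum n q = parkEnum n q := by
  have h := parkSum_eq_connSum n q (0 : Fin (n + 1)) (univ.map (Fin.succEmb n)) (by simp) (by simp)
  rw [parkSum_map_succ, connSum_map_succ, card_map, card_univ, Fintype.card_fin] at h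
  have h2 : n * n = n.choose 2 + (n + 1).choose 2 := by
    rw [Nat.choose_succ_left _ _ (by simp)]
    have := sum_range_id_mul_two n
    rw [sum_range_id, ← Nat.choose_two_right] at this
    cases n with
    | zero => rfl
    | succ m =>
      simp at this ⊢
      linarith
  rw [h2, pow_add, ← mul_assoc, mul_assoc (_ * _) (q ^ n.choose 2),
    mul_assoc (_ * _) (q ^ n.choose 2), ← pow_add] at h
  exact (mul_left_cancel₀ (pow_ne_zero n (sub_ne_zero.2 h1))
    (mul_right_cancel₀ (pow_ne_zero _ h0) h)).symm

theorem connEnum_eq_parkEnum (n : ℕ) (q : ℤ) : connEnum n q = parkEnum n q := by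
  have h := connEnum_eq_parkEnum_of_isDomain n (Polynomial.X : Polynomial ℤ)
    Polynomial.X_ne_zero fun h => by simpa using congrArg Polynomial.natDegree h
  simpa [connEnum, parkEnum, Polynomial.eval_finsetSum] using congrArg (Polynomial.eval q) h

theorem tutteK_one_eq_connEnum (n : ℕ) (q : ℤ) : tutteK n 1 q = connEnum n q := by
  classical
  have hE : edgesOn (univ : Finset (Fin (n + 1))) = (⊤ : SimpleGraph (Fin (n + 1))).edgeFinset := by
    ext e
    induction e with
    | _ x y => simp [mk_mem_edgesOn]
  have hterm : ∀ A ⊆ edgesOn (univ : Finset (Fin (n + 1))),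
      (1 - 1 : ℤ) ^ (rk (edgesOn (univ : Finset (Fin (n + 1)))).val - rk A.val) *
        (q - 1) ^ (#A - rk A.val) =
      if reachSet 0 A = univ.map (Fin.succEmb n) then (q - 1) ^ (#A - n) else 0 := by
    intro A hA
    have hfull : comps (edgesOn (univ : Finset (Fin (n + 1)))).val = 1 := by
      rw [comps_eq_one_iff]
      have : mAdj (edgesOn (univ : Finset (Fin (n + 1)))).val = ⊤ := by
        ext x y
        simp only [mAdj, SimpleGraph.fromRel_adj, mem_val, mk_mem_edgesOn, SimpleGraph.top_adj]
        simp only [mem_univ, true_and]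
        tauto
      rw [this]
      exact SimpleGraph.connected_top
    have hpos := comps_pos A.val
    rw [rk, rk, hfull, Fintype.card_fin]
    split_ifs with h
    · rw [(comps_eq_one_iff _).2 ((connected_mAdj_iff hA).2 h)]
      simp
    · have h1 : comps A.val ≠ 1 := fun h1 =>
        h ((connected_mAdj_iff hA).1 ((comps_eq_one_iff _).1 h1))
      have hle : comps A.val ≤ n + 1 := by
        have := Nat.card_le_card_of_surjective (mAdj A.val).connectedComponentMk
          Quot.mk_surjective
        simpa [comps] using this
      rw [sub_self, zero_pow (by omega), zero_mul]
  rw [connEnum, sum_filter, ← sum_congr rfl fun A hA => hterm A (mem_powerset.1 hA), tutteK, tutte,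
    hE]
  have hmap : ∀ A : Finset ↥(⊤ : SimpleGraph (Fin (n + 1))).edgeFinset,
      A.val.map Subtype.val = (A.map (Function.Embedding.subtype _)).val :=
    fun A => rfl
  have huniv : (univ : Finset ↥(⊤ : SimpleGraph (Fin (n + 1))).edgeFinset).map
      (Function.Embedding.subtype _) = (⊤ : SimpleGraph (Fin (n + 1))).edgeFinset := by
    ext e
    simp
  refine sum_bij (fun A _ => A.map (Function.Embedding.subtype _)) ?_ ?_ ?_ ?_
  · intro A _
    rw [mem_powerset]
    intro e he
    obtain ⟨e, -, rfl⟩ := mem_map.1 he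
    exact e.2
  · intro A _ B _ h
    exact map_injective _ h
  · intro B hB
    exact ⟨B.subtype _, mem_univ _, subtype_map_of_mem fun e he => mem_powerset.1 hB he⟩
  · intro A _
    rw [hmap, hmap, huniv, card_map]

end Specialization

open scoped Classical in
/-- `T_{K_{n+1}}(1,q)` is the generating function of classical parking
functions by complemented sum. -/
theorem tutte_complete_inversion (n : ℕ) (q : ℤ) :
    tutteK n 1 q =
      ∑ a ∈ Finset.univ.filter (fun a : Fin n → Fin n => IsPF n (fun i => (a i : ℕ))),
        q ^ (n.choose 2 - ∑ i, (a i : ℕ)) := by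
  rw [tutteK_one_eq_connEnum, connEnum_eq_parkEnum, parkEnum]
end
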